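/- arXiv:1812.03095 — 3 statements merged into one kernel-verified Lean document; each statement's English description precedes it below -/
import Mathlib

section
/- Let ψ be a symmetric cone obstacle with valley [0,s] and peak A (A > 0, s ∈ (0,1/2)), and suppose u ∈ G_ψ is a minimizer of E in G_ψ. Then u(x) = ψ(x) if and only if x = 1/2. -/
open MeasureTheory Set Topology Filter

noncomputable section

/-- A function of class `W^{2,2}(0,1)`, identified with its `C¹([0,1])` representative:
`u` has weak derivatives `du`, `ddu` (encoded through the fundamental theorem of calculus)
with `du, ddu ∈ L¹(0,1)` and `ddu ∈ L²(0,1)`. -/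
structure W22 where
  u : ℝ → ℝ
  du : ℝ → ℝ
  ddu : ℝ → ℝ
  du_int : IntegrableOn du (Icc (0:ℝ) 1)
  ddu_int : IntegrableOn ddu (Icc (0:ℝ) 1)
  ddu_sq : IntegrableOn (fun x => (ddu x)^2) (Icc (0:ℝ) 1)
  ftc_u : ∀ x ∈ Icc (0:ℝ) 1, u x = u 0 + ∫ s in (0:ℝ)..x, du s
  ftc_du : ∀ x ∈ Icc (0:ℝ) 1, du x = du 0 + ∫ s in (0:ℝ)..x, ddu s

/-- The elastic energy of a graph. -/
def graphE (f : W22) : ℝ :=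
  ∫ x in Ioo (0:ℝ) 1, (f.ddu x)^2 / (1 + (f.du x)^2) ^ ((5:ℝ)/2)

/-- The length of a graph. -/
def graphLen (f : W22) : ℝ :=
  ∫ x in Ioo (0:ℝ) 1, Real.sqrt (1 + (f.du x)^2)

/-- The length-penalized elastic energy of a graph. -/
def graphPE (ε : ℝ) (f : W22) : ℝ := graphE f + ε * graphLen f

/-- Membership in the admissible class `G_ψ`. -/
def MemG (ψ : ℝ → ℝ) (f : W22) : Prop :=
  f.u 0 = 0 ∧ f.u 1 = 0 ∧ ∀ x ∈ Icc (0:ℝ) 1, ψ x ≤ f.u x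

/-- An admissible obstacle. -/
structure Admissible (ψ : ℝ → ℝ) : Prop where
  cont : ContinuousOn ψ (Icc 0 1)
  neg0 : ψ 0 < 0
  neg1 : ψ 1 < 0
  pos : ∃ x ∈ Icc (0:ℝ) 1, 0 < ψ x
  osd : ∃ C : ℝ, ∀ x ∈ Ioo (0:ℝ) 1,
      (∃ d : ℝ, |d| ≤ C ∧ HasDerivWithinAt ψ d (Ici x) x) ∧
      (∃ d : ℝ, |d| ≤ C ∧ HasDerivWithinAt ψ d (Iic x) x)

/-- `‖ψ'‖_∞`, the smallest uniform bound for the one-sided derivatives of `ψ` on `(0,1)`. -/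
def obstNorm (ψ : ℝ → ℝ) : ℝ :=
  sInf {C : ℝ | 0 ≤ C ∧ ∀ x ∈ Ioo (0:ℝ) 1, ∀ d : ℝ,
    (HasDerivWithinAt ψ d (Ici x) x ∨ HasDerivWithinAt ψ d (Iic x) x) → |d| ≤ C}

/-- A planar curve on `(0,1)` of class `W^{1,1}((0,1);ℝ²)`. -/
structure Curve1 where
  x : ℝ → ℝ
  y : ℝ → ℝ
  dx : ℝ → ℝ
  dy : ℝ → ℝ
  dx_int : IntegrableOn dx (Icc (0:ℝ) 1)
  dy_int : IntegrableOn dy (Icc (0:ℝ) 1)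
  ftc_x : ∀ t ∈ Icc (0:ℝ) 1, x t = x 0 + ∫ s in (0:ℝ)..t, dx s
  ftc_y : ∀ t ∈ Icc (0:ℝ) 1, y t = y 0 + ∫ s in (0:ℝ)..t, dy s

/-- A planar curve of class `W^{1,1}((0,1);ℝ²) ∩ W^{2,1}_loc((0,1);ℝ²)`. -/
structure Curve extends Curve1 where
  ddx : ℝ → ℝ
  ddy : ℝ → ℝ
  ddx_loc : ∀ a b : ℝ, 0 < a → b < 1 → IntegrableOn ddx (Icc a b)
  ddy_loc : ∀ a b : ℝ, 0 < a → b < 1 → IntegrableOn ddy (Icc a b)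
  ftc_dx : ∀ a ∈ Ioo (0:ℝ) 1, ∀ t ∈ Ioo (0:ℝ) 1, dx t = dx a + ∫ s in a..t, ddx s
  ftc_dy : ∀ a ∈ Ioo (0:ℝ) 1, ∀ t ∈ Ioo (0:ℝ) 1, dy t = dy a + ∫ s in a..t, ddy s

/-- `|γ'(t)|`. -/
def speed1 (γ : Curve1) (t : ℝ) : ℝ := Real.sqrt ((γ.dx t)^2 + (γ.dy t)^2)

/-- The length `L(γ) = ∫₀¹ |γ'| dt`, as an extended real number. -/
def len1E (γ : Curve1) : ENNReal := ∫⁻ t in Ioo (0:ℝ) 1, ENNReal.ofReal (speed1 γ t)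

/-- The length `L(γ)`, as a real number. -/
def len1 (γ : Curve1) : ℝ := ∫ t in Ioo (0:ℝ) 1, speed1 γ t

def lenE (γ : Curve) : ENNReal := len1E γ.toCurve1

/-- The integrand `⟨γ'', N_γ⟩²/|γ'|³` of the elastic energy. -/
def elInt (γ : Curve) (t : ℝ) : ℝ :=
  (γ.dx t * γ.ddy t - γ.dy t * γ.ddx t)^2 / ((γ.dx t)^2 + (γ.dy t)^2) ^ ((5:ℝ)/2)

/-- Elastic energy of a curve, as an extended real number. -/
def elE (γ : Curve) : ENNReal := ∫⁻ t in Ioo (0:ℝ) 1, ENNReal.ofReal (elInt γ t)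

/-- The length-penalized elastic energy `E_ε = E + ε·L`. -/
def penE (ε : ℝ) (γ : Curve) : ENNReal := elE γ + ENNReal.ofReal ε * lenE γ

/-- A curve is immersed if `|γ'| > ε` on `(0,1)` for some `ε > 0`. -/
def Curve.Immersed (γ : Curve) : Prop :=
  ∃ ε > 0, ∀ t ∈ Ioo (0:ℝ) 1, ε < speed1 γ.toCurve1 t

/-- `u` lies in `W^{2,2}_loc(c,d)` with weak derivatives `du`, `ddu`. -/
structure W22locOn (u du ddu : ℝ → ℝ) (c d : ℝ) : Prop where
  du_loc : ∀ a b : ℝ, c < a → b < d → IntegrableOn du (Icc a b)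
  ddu_loc : ∀ a b : ℝ, c < a → b < d → IntegrableOn ddu (Icc a b)
  ddu_sq : ∀ a b : ℝ, c < a → b < d → IntegrableOn (fun t => (ddu t)^2) (Icc a b)
  ftc_u : ∀ a ∈ Ioo c d, ∀ t ∈ Ioo c d, u t = u a + ∫ s in a..t, du s
  ftc_du : ∀ a ∈ Ioo c d, ∀ t ∈ Ioo c d, du t = du a + ∫ s in a..t, ddu s

/-- `γ` is a pseudograph. -/
def Pseudograph (γ : Curve) : Prop :=
  γ.Immersed ∧ (∀ t ∈ Ioo (0:ℝ) 1, 0 ≤ γ.dx t) ∧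
  ∀ a b : ℝ, 0 ≤ a → a < b → b ≤ 1 → (∀ t ∈ Ioo a b, 0 < γ.dx t) →
    ∃ u du ddu : ℝ → ℝ, W22locOn u du ddu (γ.x a) (γ.x b) ∧
      ∀ t ∈ Ioo a b, u (γ.x t) = γ.y t

/-- Membership in `P_ψ`. -/
def MemP (ψ : ℝ → ℝ) (γ : Curve) : Prop :=
  Pseudograph γ ∧ γ.x 0 = 0 ∧ γ.y 0 = 0 ∧ γ.x 1 = 1 ∧ γ.y 1 = 0 ∧
  ∀ t ∈ Icc (0:ℝ) 1, ψ (γ.x t) ≤ γ.y t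

/-- `v : (a,b) → (c,d)` is invertible in `W^{1,1}` (increasing case): it has an
inverse `w` which is again of class `W^{1,1}`. -/
def InvertibleW11On (v : ℝ → ℝ) (a b c d : ℝ) : Prop :=
  ∃ w dw : ℝ → ℝ, IntegrableOn dw (Icc c d) ∧
    (∀ s ∈ Icc c d, w s = w c + ∫ r in c..s, dw r) ∧
    (∀ t ∈ Ioo a b, v t ∈ Ioo c d ∧ w (v t) = t) ∧
    (∀ s ∈ Ioo c d, w s ∈ Ioo a b ∧ v (w s) = s)

/-- `γ ∈ M_{γ₀}`: a `∩`-shaped curve above `γ₀` with parameters `β₁, β₂` and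
graph reparametrization `u`. -/
structure CapAbove (γ : Curve1) (γ₀ : Curve) (β₁ β₂ : ℝ) (u : ℝ → ℝ) : Prop where
  ep0 : γ.x 0 = 0 ∧ γ.y 0 = 0
  ep1 : γ.x 1 = 1 ∧ γ.y 1 = 0
  hβ : 0 ≤ β₁ ∧ β₁ < β₂ ∧ β₂ ≤ 1
  left : ∀ t ∈ Icc (0:ℝ) β₁, γ.x t = 0
  right : ∀ t ∈ Icc β₂ (1:ℝ), γ.x t = 1
  inv : InvertibleW11On γ.x β₁ β₂ 0 1
  graph : ∀ t ∈ Ioo β₁ β₂, u (γ.x t) = γ.y t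
  ucont : ContinuousOn u (Icc (0:ℝ) 1)
  above : ∀ t ∈ Icc (0:ℝ) 1, γ₀.y t ≤ u (γ₀.x t)

/-- A `∩`-shaped pseudograph with parameters `β₁, β₂` and graph reparametrization `u`
(with weak derivatives `du`, `ddu`). -/
structure CapShaped (γ : Curve) (β₁ β₂ : ℝ) (u du ddu : ℝ → ℝ) : Prop where
  hβ : 0 ≤ β₁ ∧ β₁ < β₂ ∧ β₂ ≤ 1
  left : ∀ t ∈ Icc (0:ℝ) β₁, γ.x t = 0
  right : ∀ t ∈ Icc β₂ (1:ℝ), γ.x t = 1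
  pos : ∀ t ∈ Ioo β₁ β₂, 0 < γ.dx t
  graph : ∀ t ∈ Ioo β₁ β₂, u (γ.x t) = γ.y t
  reg : W22locOn u du ddu 0 1

/-- `G(x) = ∫₀ˣ (1+s²)^{-5/4} ds`. -/
def Gfun (x : ℝ) : ℝ := ∫ s in (0:ℝ)..x, ((1 + s^2) ^ (-(5:ℝ)/4) : ℝ)

/-- `c₀ = ∫_ℝ (1+s²)^{-5/4} ds`. -/
def c0 : ℝ := ∫ s : ℝ, ((1 + s^2) ^ (-(5:ℝ)/4) : ℝ)

/-- The inverse of `G`. -/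
def Ginv : ℝ → ℝ := Function.invFun Gfun

/-- The ratio `R(B)` from the nonexistence theorem. -/
def ratio (B : ℝ) : ℝ :=
  (∫ t in (0:ℝ)..B, t / (Real.sqrt (B - t) * (1 + t^2) ^ ((5:ℝ)/4))) /
  (2 * ∫ t in (0:ℝ)..B, 1 / (Real.sqrt (B - t) * (1 + t^2) ^ ((5:ℝ)/4)))

/-- The symmetric cone obstacle with valley `[0,s]` and peak `A`. -/
def coneObstacle (A s : ℝ) : ℝ → ℝ := fun x =>
  if x ≤ 1/2 then A / (1/2 - s) * (x - s) else A / (1/2 - s) * (1 - s - x)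
lemma AbsolutelyContinuousOnInterval.of_dist_le {f g : ℝ → ℝ} {a b : ℝ}
    (hg : AbsolutelyContinuousOnInterval g a b)
    (h : ∀ x ∈ uIcc a b, ∀ y ∈ uIcc a b, dist (f x) (f y) ≤ dist (g x) (g y)) :
    AbsolutelyContinuousOnInterval f a b := by
  rw [absolutelyContinuousOnInterval_iff] at hg ⊢
  intro ε hε
  obtain ⟨δ, hδ, H⟩ := hg ε hε
  refine ⟨δ, hδ, fun E hE hEδ => lt_of_le_of_lt (Finset.sum_le_sum fun i hi => ?_) (H E hE hEδ)⟩
  exact h _ (hE.1 i hi).1 _ (hE.1 i hi).2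

namespace W22

lemma intervalIntegrable_ddu (u : W22) : IntervalIntegrable u.ddu volume 0 1 :=
  (intervalIntegrable_iff_integrableOn_Icc_of_le zero_le_one).2 u.ddu_int

lemma absolutelyContinuous_du (u : W22) : AbsolutelyContinuousOnInterval u.du 0 1 := by
  refine (u.intervalIntegrable_ddu.absolutelyContinuousOnInterval_intervalIntegral
    (c := 0) (by simp)).of_dist_le fun x hx y hy => ?_
  rw [uIcc_of_le zero_le_one] at hx hy
  rw [u.ftc_du x hx, u.ftc_du y hy]
  simp

lemma continuousOn_du (u : W22) : ContinuousOn u.du (Icc 0 1) := by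
  simpa using u.absolutelyContinuous_du.continuousOn

lemma intervalIntegrable_du (u : W22) {x y : ℝ} (hx : x ∈ Icc (0:ℝ) 1) (hy : y ∈ Icc (0:ℝ) 1) :
    IntervalIntegrable u.du volume x y :=
  (u.continuousOn_du.mono (uIcc_subset_Icc hx hy)).intervalIntegrable

lemma u_sub (u : W22) {x y : ℝ} (hx : x ∈ Icc (0:ℝ) 1) (hy : y ∈ Icc (0:ℝ) 1) :
    u.u y - u.u x = ∫ t in x..y, u.du t := by
  have h0 : (0:ℝ) ∈ Icc (0:ℝ) 1 := by simp
  rw [u.ftc_u x hx, u.ftc_u y hy, ← intervalIntegral.integral_interval_sub_left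
    (u.intervalIntegrable_du h0 hy) (u.intervalIntegrable_du h0 hx)]
  ring

lemma continuousOn_u (u : W22) : ContinuousOn u.u (Icc 0 1) := by
  have h := intervalIntegral.continuousOn_primitive_interval' (μ := volume)
    (u.intervalIntegrable_du (x := 0) (y := 1) (by simp) (by simp)) (a := 0) (by simp)
  rw [uIcc_of_le zero_le_one] at h
  exact (continuousOn_const.add h).congr fun x hx => u.ftc_u x hx

lemma hasDerivAt_u (u : W22) {x : ℝ} (hx : x ∈ Ioo (0:ℝ) 1) : HasDerivAt u.u (u.du x) x := by
  have hI : Icc (0:ℝ) 1 ∈ 𝓝 x := Icc_mem_nhds hx.1 hx.2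
  have h := intervalIntegral.integral_hasDerivAt_right
    (u.intervalIntegrable_du (x := 0) (y := x) (by simp) (Ioo_subset_Icc_self hx))
    (u.continuousOn_du.stronglyMeasurableAtFilter_nhdsWithin measurableSet_Icc x |>.filter_mono
      (by rw [nhdsWithin_eq_nhds.2 hI]))
    (u.continuousOn_du.continuousAt hI)
  refine (h.const_add (u.u 0)).congr_of_eventuallyEq ?_
  filter_upwards [hI] with y hy using u.ftc_u y hy

lemma ae_hasDerivAt_du (u : W22) : ∀ᵐ x, x ∈ Ioo (0:ℝ) 1 → HasDerivAt u.du (u.ddu x) x := by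
  filter_upwards [u.intervalIntegrable_ddu.ae_hasDerivAt_integral] with x h hx
  have hI : Icc (0:ℝ) 1 ∈ 𝓝 x := Icc_mem_nhds hx.1 hx.2
  have h' := h (by simpa using Ioo_subset_Icc_self hx) 0 (by simp)
  refine (h'.const_add (u.du 0)).congr_of_eventuallyEq ?_
  filter_upwards [hI] with y hy using u.ftc_du y hy

/-- The function vanishing at `0` with prescribed absolutely continuous derivative `p`. -/
def ofDeriv (p : ℝ → ℝ) (hp : AbsolutelyContinuousOnInterval p 0 1)
    (hsq : IntegrableOn (fun x => (deriv p x) ^ 2) (Icc (0:ℝ) 1)) : W22 where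
  u := fun x => ∫ t in (0:ℝ)..x, p t
  du := p
  ddu := deriv p
  du_int := by
    have h := hp.continuousOn
    rw [uIcc_of_le zero_le_one] at h
    exact h.integrableOn_Icc
  ddu_int := (intervalIntegrable_iff_integrableOn_Icc_of_le zero_le_one).1
    hp.intervalIntegrable_deriv
  ddu_sq := hsq
  ftc_u := by simp
  ftc_du := by
    intro x hx
    rw [(hp.mono (uIcc_subset_uIcc (by simp) (by simpa using hx))).integral_deriv_eq_sub]
    ring

/-- The energy density of `graphE`. -/
def density (u : W22) (x : ℝ) : ℝ := (u.ddu x) ^ 2 / (1 + (u.du x) ^ 2) ^ ((5:ℝ) / 2)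

lemma one_le_weight (y : ℝ) : (1:ℝ) ≤ (1 + y ^ 2) ^ ((5:ℝ) / 2) :=
  Real.one_le_rpow (by nlinarith [sq_nonneg y]) (by norm_num)

lemma density_nonneg (u : W22) (x : ℝ) : 0 ≤ u.density x :=
  div_nonneg (sq_nonneg _) (zero_le_one.trans (one_le_weight _))

lemma integrableOn_density (u : W22) : IntegrableOn u.density (Ioo 0 1) := by
  have hd : AEStronglyMeasurable u.du (volume.restrict (Ioo (0:ℝ) 1)) :=
    (u.continuousOn_du.mono Ioo_subset_Icc_self).aestronglyMeasurable measurableSet_Ioo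
  have hdd := (u.ddu_int.mono_set Ioo_subset_Icc_self).aestronglyMeasurable.aemeasurable
  refine Integrable.mono' (u.ddu_sq.mono_set Ioo_subset_Icc_self) ?_ (ae_of_all _ fun x => ?_)
  · exact ((hdd.pow_const 2).div
      ((hd.aemeasurable.pow_const 2).const_add 1 |>.pow_const _)).aestronglyMeasurable
  · rw [Real.norm_of_nonneg (u.density_nonneg x)]
    exact div_le_self (sq_nonneg _) (one_le_weight _)

/-- Reflection at `x = 1/2`. -/
def reflect (u : W22) : W22 where
  u := fun x => u.u (1 - x)
  du := fun x => -u.du (1 - x)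
  ddu := fun x => u.ddu (1 - x)
  du_int := by
    rw [← intervalIntegrable_iff_integrableOn_Icc_of_le zero_le_one]
    have h := ((u.intervalIntegrable_du (x := 0) (y := 1) (by simp) (by simp)).comp_sub_left 1).neg
    simpa using! h.symm
  ddu_int := by
    rw [← intervalIntegrable_iff_integrableOn_Icc_of_le zero_le_one]
    have h := u.intervalIntegrable_ddu.comp_sub_left 1
    simpa using! h.symm
  ddu_sq := by
    rw [← intervalIntegrable_iff_integrableOn_Icc_of_le zero_le_one]
    have h := ((intervalIntegrable_iff_integrableOn_Icc_of_le zero_le_one).2 u.ddu_sq).comp_sub_left 1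
    simpa using! h.symm
  ftc_u := by
    intro x hx
    have hx' : 1 - x ∈ Icc (0:ℝ) 1 := ⟨by linarith [hx.2], by linarith [hx.1]⟩
    have h := u.u_sub (x := 1 - x) (y := 1) hx' (by simp)
    rw [intervalIntegral.integral_neg, intervalIntegral.integral_comp_sub_left (fun t => u.du t),
      sub_zero, ← h]
    ring
  ftc_du := by
    intro x hx
    have hx' : 1 - x ∈ Icc (0:ℝ) 1 := ⟨by linarith [hx.2], by linarith [hx.1]⟩
    have hi := u.intervalIntegrable_ddu
    have h : u.du 1 - u.du (1 - x) = ∫ t in (1 - x)..1, u.ddu t := by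
      rw [u.ftc_du 1 (by simp), u.ftc_du _ hx', add_sub_add_left_eq_sub]
      exact intervalIntegral.integral_interval_sub_left hi
        (hi.mono_set (uIcc_subset_uIcc (by simp) (by simpa using! hx')))
    rw [intervalIntegral.integral_comp_sub_left (fun t => u.ddu t), sub_zero, ← h]
    ring

lemma graphE_reflect (u : W22) : graphE u.reflect = graphE u := by
  have h := intervalIntegral.integral_comp_sub_left (a := 0) (b := 1) u.density 1
  rw [sub_self, sub_zero, intervalIntegral.integral_of_le zero_le_one,
    intervalIntegral.integral_of_le zero_le_one, integral_Ioc_eq_integral_Ioo,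
    integral_Ioc_eq_integral_Ioo] at h
  rw [graphE, graphE]
  simpa [reflect, density] using h

end W22

namespace W22

/-- The truncation of `f` from below by `a` on `(-∞, b]` and from above by `C`. -/
def trunc (f : ℝ → ℝ) (b a C : ℝ) (x : ℝ) : ℝ := min (f x + max (a - f (min x b)) 0) C

lemma trunc_of_le (f : ℝ → ℝ) {b x : ℝ} (a C : ℝ) (h : x ≤ b) :
    trunc f b a C x = min (max (f x) a) C := by
  rw [trunc, min_eq_left h]
  congr 1
  grind

lemma trunc_of_ge {f : ℝ → ℝ} {a b x : ℝ} (C : ℝ) (ha : a ≤ f b) (h : b ≤ x) :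
    trunc f b a C x = min (f x) C := by
  rw [trunc, min_eq_right h, max_eq_right (by linarith), add_zero]

lemma dist_trunc_le (f : ℝ → ℝ) (b a C x y : ℝ) :
    |trunc f b a C x - trunc f b a C y| ≤ |f x - f y| + |f (min x b) - f (min y b)| := by
  refine (abs_min_sub_min_le_max _ _ _ _).trans ?_
  rw [sub_self, abs_zero, max_eq_left (abs_nonneg _), add_sub_add_comm]
  refine (abs_add_le _ _).trans (add_le_add_right ?_ _)
  refine (abs_max_sub_max_le_max _ _ _ _).trans ?_
  rw [sub_self, abs_zero, max_eq_left (abs_nonneg _), sub_sub_sub_cancel_left, abs_sub_comm]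

lemma absolutelyContinuous_trunc (u : W22) {b : ℝ} (hb : 0 ≤ b) (a C : ℝ) :
    AbsolutelyContinuousOnInterval (trunc u.du b a C) 0 1 := by
  have hi := u.intervalIntegrable_ddu.norm
  have hsub {x y : ℝ} (hx : x ∈ uIcc (0:ℝ) 1) (hy : y ∈ uIcc (0:ℝ) 1) :
      IntervalIntegrable (fun t => ‖u.ddu t‖) volume x y := hi.mono_set (uIcc_subset_uIcc hx hy)
  refine ((hi.absolutelyContinuousOnInterval_intervalIntegral (c := 0) (by simp)).const_mul
    2).of_dist_le ?_
  suffices H : ∀ x ∈ uIcc (0:ℝ) 1, ∀ y ∈ uIcc (0:ℝ) 1, x ≤ y →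
      dist (trunc u.du b a C x) (trunc u.du b a C y) ≤
        dist (2 * ∫ t in (0:ℝ)..x, ‖u.ddu t‖) (2 * ∫ t in (0:ℝ)..y, ‖u.ddu t‖) by
    intro x hx y hy
    rcases le_total x y with h | h
    · exact H x hx y hy h
    · rw [dist_comm, dist_comm (2 * _)]
      exact H y hy x hx h
  intro x hx y hy hxy
  have hdu {x y : ℝ} (hx : x ∈ uIcc (0:ℝ) 1) (hy : y ∈ uIcc (0:ℝ) 1) (hxy : x ≤ y) :
      |u.du x - u.du y| ≤ ∫ t in x..y, ‖u.ddu t‖ := by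
    have h : u.du y - u.du x = ∫ t in x..y, u.ddu t := by
      rw [uIcc_of_le zero_le_one] at hx hy
      rw [u.ftc_du x hx, u.ftc_du y hy, add_sub_add_left_eq_sub]
      exact intervalIntegral.integral_interval_sub_left
        (u.intervalIntegrable_ddu.mono_set (uIcc_subset_uIcc (by simp) (by simpa using! hy)))
        (u.intervalIntegrable_ddu.mono_set (uIcc_subset_uIcc (by simp) (by simpa using! hx)))
    rw [abs_sub_comm, h, ← Real.norm_eq_abs]
    exact intervalIntegral.norm_integral_le_integral_norm hxy
  have hmem {x : ℝ} (hx : x ∈ uIcc (0:ℝ) 1) : min x b ∈ uIcc (0:ℝ) 1 := by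
    rw [uIcc_of_le zero_le_one] at hx ⊢
    exact ⟨le_min hx.1 hb, (min_le_left _ _).trans hx.2⟩
  have h1 := hdu hx hy hxy
  have h2 : |u.du (min x b) - u.du (min y b)| ≤ ∫ t in x..y, ‖u.ddu t‖ := by
    rcases le_total b x with h | h
    · rw [min_eq_right h, min_eq_right (h.trans hxy), sub_self, abs_zero]
      exact intervalIntegral.integral_nonneg hxy fun t _ => norm_nonneg _
    · refine (hdu (hmem hx) (hmem hy) (min_le_min_right _ hxy)).trans ?_
      rw [min_eq_left h]
      refine intervalIntegral.integral_mono_interval le_rfl (le_min hxy h) (min_le_left _ _)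
        (ae_of_all _ fun t => norm_nonneg _) (hsub hx hy)
  have h3 := intervalIntegral.integral_interval_sub_left (hsub (x := 0) (by simp) hy)
    (hsub (x := 0) (by simp) hx)
  rw [dist_comm (2 * _), Real.dist_eq, Real.dist_eq, ← mul_sub, h3]
  refine (dist_trunc_le _ _ _ _ _ _).trans (le_trans ?_ (le_abs_self _))
  linarith

/-- Where both `f` and its truncation are differentiable, the derivative of the truncation
either vanishes or agrees with that of `f`. -/
lemma deriv_trunc {f : ℝ → ℝ} {b a C x f' : ℝ} (hb : b = 1 ∨ a ≤ f b) (hx1 : x < 1)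
    (hxb : x ≠ b) (hf : HasDerivAt f f' x) (hp : DifferentiableAt ℝ (trunc f b a C) x) :
    deriv (trunc f b a C) x = 0 ∨
      (deriv (trunc f b a C) x = f' ∧ trunc f b a C x = f x ∧ (x < b → a ≤ f x)) := by
  have hpc := hp.continuousAt
  have hfc := hf.continuousAt
  have hle : ∀ y, trunc f b a C y ≤ C := fun y => min_le_right _ _
  rcases (hle x).eq_or_lt with hC | hC
  · exact Or.inl (IsLocalMax.deriv_eq_zero (Eventually.of_forall fun y => by rw [hC]; exact hle y))
  have hClt := hpc.eventually (gt_mem_nhds hC)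
  rcases hxb.lt_or_gt with h | h
  · have hev : trunc f b a C =ᶠ[𝓝 x] fun y => max (f y) a := by
      filter_upwards [hClt, gt_mem_nhds h] with y hy hyb
      rw [trunc_of_le f a C hyb.le] at hy ⊢
      grind
    have hxe := hev.eq_of_nhds
    rcases lt_or_ge a (f x) with hax | hax
    · right
      have hev' : trunc f b a C =ᶠ[𝓝 x] f := by
        filter_upwards [hev, hfc.eventually (lt_mem_nhds hax)] with y hy hya
        rw [hy, max_eq_left hya.le]
      exact ⟨hev'.deriv_eq.trans hf.deriv, hev'.eq_of_nhds, fun _ => hax.le⟩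
    · left
      refine IsLocalMin.deriv_eq_zero ?_
      filter_upwards [hev] with y hy
      rw [hy, hxe, max_eq_right hax]
      exact le_max_right _ _
  · right
    have hab : a ≤ f b := hb.resolve_left (by rintro rfl; linarith)
    have hev : trunc f b a C =ᶠ[𝓝 x] f := by
      filter_upwards [hClt, lt_mem_nhds h] with y hy hyb
      rw [trunc_of_ge C hab hyb.le] at hy ⊢
      grind
    exact ⟨hev.deriv_eq.trans hf.deriv, hev.eq_of_nhds, fun h' => absurd h' h.not_gt⟩

lemma ae_deriv_trunc (u : W22) {b a : ℝ} (C : ℝ) (hb0 : 0 ≤ b) (hb : b = 1 ∨ a ≤ u.du b) :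
    ∀ᵐ x, x ∈ Ioo (0:ℝ) 1 → (deriv (trunc u.du b a C) x = 0 ∨
      (deriv (trunc u.du b a C) x = u.ddu x ∧ trunc u.du b a C x = u.du x ∧
        (x < b → a ≤ u.du x))) := by
  filter_upwards [u.ae_hasDerivAt_du, (u.absolutelyContinuous_trunc hb0 a C).ae_differentiableAt,
    Measure.ae_ne volume b] with x h1 h2 h3 hx
  exact deriv_trunc hb hx.2 h3 (h1 hx) (h2 (by simpa using Ioo_subset_Icc_self hx))

lemma exists_integral_trunc_eq_zero (u : W22) {b : ℝ} (hb0 : 0 ≤ b) (a : ℝ)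
    (hint : 0 ≤ ∫ t in (0:ℝ)..1, u.du t) :
    ∃ C, ∫ t in (0:ℝ)..1, trunc u.du b a C t = 0 := by
  have hii : ∀ C, IntervalIntegrable (trunc u.du b a C) volume 0 1 := fun C =>
    (u.absolutelyContinuous_trunc hb0 a C).continuousOn.intervalIntegrable
  set q : ℝ → ℝ := fun x => u.du x + max (a - u.du (min x b)) 0 with hq
  have hqc : ContinuousOn q (Icc 0 1) := by
    refine u.continuousOn_du.add (ContinuousOn.sup (continuousOn_const.sub
      (u.continuousOn_du.comp (by fun_prop) fun x hx => ?_)) continuousOn_const)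
    exact ⟨le_min hx.1 hb0, (min_le_left _ _).trans hx.2⟩
  obtain ⟨M, hM⟩ := isCompact_Icc.exists_bound_of_continuousOn hqc
  have hM0 : 0 ≤ M := (norm_nonneg _).trans (hM 0 (by simp))
  have hcont : Continuous fun C => ∫ t in (0:ℝ)..1, trunc u.du b a C t := by
    refine (LipschitzWith.of_dist_le_mul (K := 1) fun C D => ?_).continuous
    rw [dist_eq_norm, ← intervalIntegral.integral_sub (hii C) (hii D)]
    have := intervalIntegral.norm_integral_le_of_norm_le_const (a := 0) (b := 1) (C := |C - D|)
      (f := fun t => trunc u.du b a C t - trunc u.du b a D t) fun t _ => by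
        refine (abs_min_sub_min_le_max _ _ _ _).trans ?_
        simp
    simpa [Real.dist_eq] using this
  have hlow : ∫ t in (0:ℝ)..1, trunc u.du b a 0 t ≤ 0 := by
    have := intervalIntegral.integral_mono_on zero_le_one (hii 0)
      (intervalIntegrable_const (c := (0:ℝ))) fun t _ => (min_le_right _ _ : trunc u.du b a 0 t ≤ 0)
    simpa using this
  have hhigh : 0 ≤ ∫ t in (0:ℝ)..1, trunc u.du b a M t := by
    refine hint.trans (intervalIntegral.integral_mono_on zero_le_one
      (u.intervalIntegrable_du (by simp) (by simp)) (hii M) fun t ht => ?_)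
    have h1 : q t ≤ M := (le_abs_self _).trans (hM t ht)
    have h2 : u.du t ≤ q t := le_add_of_nonneg_right (le_max_right _ _)
    exact le_min h2 (h2.trans h1)
  obtain ⟨C, -, hC⟩ := intermediate_value_Icc hM0 hcont.continuousOn ⟨hlow, hhigh⟩
  exact ⟨C, hC⟩

/-- If `u'` attains values on both sides of `a` on `[0, b]`, then truncating `u'` strictly
decreases the energy. -/
lemma exists_trunc_graphE_lt (u : W22) {b a : ℝ} (hb0 : 0 ≤ b) (hb1 : b ≤ 1)
    (hb : b = 1 ∨ a ≤ u.du b) (hint : 0 ≤ ∫ t in (0:ℝ)..1, u.du t)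
    {y z : ℝ} (hy : y ∈ Icc 0 b) (hya : u.du y < a) (hz : z ∈ Icc 0 b) (hza : a ≤ u.du z) :
    ∃ (C : ℝ) (v : W22), v.u 0 = 0 ∧ v.u 1 = 0 ∧ v.du = trunc u.du b a C ∧
      graphE v < graphE u := by
  obtain ⟨C, hC⟩ := u.exists_integral_trunc_eq_zero hb0 a hint
  have hp := u.absolutelyContinuous_trunc hb0 a C
  have hae := u.ae_deriv_trunc C hb0 hb
  have hsq : IntegrableOn (fun x => (deriv (trunc u.du b a C) x) ^ 2) (Icc (0:ℝ) 1) := by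
    rw [integrableOn_Icc_iff_integrableOn_Ioo]
    refine Integrable.mono' (u.ddu_sq.mono_set Ioo_subset_Icc_self)
      ((measurable_deriv _).pow_const 2).aestronglyMeasurable ?_
    rw [ae_restrict_iff' measurableSet_Ioo]
    filter_upwards [hae] with x hx hxI
    rw [Real.norm_of_nonneg (sq_nonneg _)]
    rcases hx hxI with h | ⟨h, -⟩
    · rw [h, zero_pow two_ne_zero]
      exact sq_nonneg _
    · rw [h]
  set v := ofDeriv _ hp hsq with hv
  refine ⟨C, v, by simp [hv, ofDeriv], hC, rfl, ?_⟩
  by_contra! hlt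
  have hdens : ∀ᵐ x, x ∈ Ioo (0:ℝ) 1 → v.density x ≤ u.density x ∧
      (x < b → u.du x < a → v.density x = 0) := by
    filter_upwards [hae] with x hx hxI
    rcases hx hxI with h | ⟨h, h', h''⟩
    · have : v.density x = 0 := by simp [density, hv, ofDeriv, h]
      exact ⟨this ▸ u.density_nonneg x, fun _ _ => this⟩
    · refine ⟨le_of_eq ?_, fun h1 h2 => absurd h2 (h'' h1).not_gt⟩
      simp [density, hv, ofDeriv, h, h']
  have hzero : ∀ᵐ x, x ∈ Ioo (0:ℝ) 1 → u.density x - v.density x = 0 := by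
    have hi := u.integrableOn_density.sub v.integrableOn_density
    have hnn : 0 ≤ᵐ[volume.restrict (Ioo (0:ℝ) 1)] (u.density - v.density) := by
      rw [EventuallyLE, ae_restrict_iff' measurableSet_Ioo]
      filter_upwards [hdens] with x hx hxI using sub_nonneg.2 (hx hxI).1
    have h0 : ∫ x in Ioo (0:ℝ) 1, (u.density - v.density) x = 0 := by
      refine le_antisymm ?_ (integral_nonneg_of_ae hnn)
      rw [integral_sub' u.integrableOn_density v.integrableOn_density]
      exact sub_nonpos.2 hlt
    have := (integral_eq_zero_iff_of_nonneg_ae hnn hi).1 h0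
    rwa [EventuallyEq, ae_restrict_iff' measurableSet_Ioo] at this
  have hsub : uIcc 0 b ⊆ uIcc (0:ℝ) 1 := uIcc_subset_uIcc (by simp) (by simp [hb0, hb1])
  have hmac : AbsolutelyContinuousOnInterval (fun x => min (u.du x) a) 0 b := by
    refine (u.absolutelyContinuous_du.mono hsub).of_dist_le fun x _ y _ => ?_
    refine (abs_min_sub_min_le_max _ _ _ _).trans ?_
    simp [Real.dist_eq]
  have hm0 : ∀ᵐ x, x ∈ uIcc 0 b → HasDerivAt (fun x => min (u.du x) a) 0 x := by
    filter_upwards [hdens, hzero, u.ae_hasDerivAt_du, hmac.ae_differentiableAt,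
      Measure.ae_ne volume 0, Measure.ae_ne volume b] with x h1 h2 h3 h4 h5 h6 hx
    have hd := h4 hx
    rw [uIcc_of_le hb0] at hx
    have hxb : x < b := lt_of_le_of_ne hx.2 h6
    have hxI : x ∈ Ioo (0:ℝ) 1 := ⟨lt_of_le_of_ne hx.1 (Ne.symm h5), hxb.trans_le hb1⟩
    rcases lt_or_ge (u.du x) a with h | h
    · have hu0 : u.density x = 0 := by
        rw [← sub_add_cancel (u.density x) (v.density x), h2 hxI, (h1 hxI).2 hxb h, add_zero]
      have hdd : u.ddu x = 0 := by
        rcases div_eq_zero_iff.1 hu0 with h | h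
        · exact pow_eq_zero_iff two_ne_zero |>.1 h
        · exact absurd h (zero_lt_one.trans_le (one_le_weight _)).ne'
      have h3' := h3 hxI
      rw [hdd] at h3'
      refine h3'.congr_of_eventuallyEq ?_
      filter_upwards [h3'.continuousAt.eventually (gt_mem_nhds h)] with y hy
      exact min_eq_left hy.le
    · have hmax : IsLocalMax (fun x => min (u.du x) a) x := by
        refine Eventually.of_forall fun y => ?_
        simp only [min_eq_right h]
        exact min_le_right _ _
      rw [← hmax.deriv_eq_zero]
      exact hd.hasDerivAt
  obtain ⟨c, hc⟩ := hmac.const_of_ae_hasDerivAt_zero hm0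
  rw [uIcc_of_le hb0] at hc
  have e1 := hc y hy
  have e2 := hc z hz
  grind

end W22

lemma coneObstacle_one_sub (A s x : ℝ) : coneObstacle A s (1 - x) = coneObstacle A s x := by
  rcases lt_trichotomy x (1/2) with h | rfl | h
  · rw [coneObstacle, coneObstacle, if_neg (by linarith), if_pos h.le]
    ring
  · norm_num
  · rw [coneObstacle, coneObstacle, if_pos (by linarith), if_neg h.not_ge]
    ring

lemma coneObstacle_of_le {A s x : ℝ} (h : x ≤ 1/2) :
    coneObstacle A s x = A / (1/2 - s) * (x - s) := if_pos h

lemma continuous_coneObstacle (A s : ℝ) : Continuous (coneObstacle A s) := by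
  refine Continuous.if_le (by fun_prop) (by fun_prop) continuous_id continuous_const ?_
  rintro x rfl
  ring

lemma MemG.reflect {A s : ℝ} {u : W22} (hu : MemG (coneObstacle A s) u) :
    MemG (coneObstacle A s) u.reflect := by
  obtain ⟨h0, h1, h⟩ := hu
  refine ⟨by simpa [W22.reflect] using h1, by simpa [W22.reflect] using h0, fun x hx => ?_⟩
  rw [← coneObstacle_one_sub]
  exact h (1 - x) ⟨by linarith [hx.2], by linarith [hx.1]⟩

/-- A minimizer does not touch the obstacle to the left of the tip. -/
lemma ne_coneObstacle_of_lt {A s : ℝ} (hA : 0 < A) (hs : s ∈ Ioo (0:ℝ) (1/2)) {u : W22}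
    (hu : MemG (coneObstacle A s) u)
    (hmin : ∀ v : W22, MemG (coneObstacle A s) v → graphE u ≤ graphE v)
    {x₀ : ℝ} (hx₀ : 0 ≤ x₀) (hx₀' : x₀ < 1/2) : u.u x₀ ≠ coneObstacle A s x₀ := by
  intro htouch
  obtain ⟨hu0, hu1, hge⟩ := hu
  set a := A / (1/2 - s) with ha_def
  have ha : 0 < a := div_pos hA (by linarith [hs.2])
  have hψ : ∀ {x}, x ≤ 1/2 → coneObstacle A s x = a * (x - s) := fun h => coneObstacle_of_le h
  rw [hψ hx₀'.le] at htouch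
  have hpos : 0 < x₀ := by
    refine hx₀.lt_of_ne ?_
    rintro rfl
    nlinarith [mul_pos ha hs.1]
  have hmem : x₀ ∈ Icc (0:ℝ) 1 := ⟨hx₀, by linarith⟩
  have hmem0 : (0:ℝ) ∈ Icc (0:ℝ) 1 := by simp
  have hmem1 : (1:ℝ) ∈ Icc (0:ℝ) 1 := by simp
  have hda : u.du x₀ = a := by
    have hd := (u.hasDerivAt_u (x := x₀) ⟨hpos, by linarith⟩).sub
      (((hasDerivAt_id x₀).sub_const s).const_mul a)
    have hm : IsLocalMin (u.u - fun x => a * (id x - s)) x₀ := by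
      filter_upwards [Ioo_mem_nhds hpos hx₀'] with x hx
      have := hge x ⟨hx.1.le, by linarith [hx.2]⟩
      rw [hψ hx.2.le] at this
      simp only [Pi.sub_apply, id, htouch]
      linarith
    have := hm.hasDerivAt_eq_zero hd
    linarith
  have hslope : ∃ y ∈ Icc 0 x₀, u.du y < a := by
    by_contra! hcon
    have h1 := u.u_sub hmem0 hmem
    have h2 := intervalIntegral.integral_mono_on hx₀ (intervalIntegrable_const (c := a))
      (u.intervalIntegrable_du hmem0 hmem) hcon
    simp only [intervalIntegral.integral_const, smul_eq_mul] at h2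
    nlinarith [mul_pos ha hs.1]
  obtain ⟨y, hy, hya⟩ := hslope
  have hint : ∫ t in (0:ℝ)..1, u.du t = 0 := by
    rw [← u.u_sub hmem0 hmem1, hu0, hu1, sub_zero]
  obtain ⟨C, v, hv0, hv1, hdv, hlt⟩ := u.exists_trunc_graphE_lt hx₀ hmem.2 (Or.inr hda.ge)
    hint.ge hy hya (right_mem_Icc.2 hx₀) hda.ge
  have hright : ∀ x ∈ Icc x₀ 1, u.u x ≤ v.u x := by
    intro x hx
    have hxm : x ∈ Icc (0:ℝ) 1 := ⟨hx₀.trans hx.1, hx.2⟩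
    have h1 := u.u_sub hxm hmem1
    have h2 := v.u_sub hxm hmem1
    have h3 := intervalIntegral.integral_mono_on hx.2 (v.intervalIntegrable_du hxm hmem1)
      (u.intervalIntegrable_du hxm hmem1) fun t ht => by
        rw [hdv, W22.trunc_of_ge C hda.ge (hx.1.trans ht.1)]
        exact min_le_left _ _
    linarith
  refine hlt.not_ge (hmin v ⟨hv0, hv1, fun x hx => ?_⟩)
  rcases le_total x₀ x with h | h
  · exact (hge x hx).trans (hright x ⟨h, hx.2⟩)
  rw [hψ (h.trans hx₀'.le)]
  rcases le_total a C with hC | hC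
  · have h1 := v.u_sub hmem0 hx
    have h2 := intervalIntegral.integral_mono_on hx.1 (intervalIntegrable_const (c := a))
      (v.intervalIntegrable_du hmem0 hx) fun t ht => by
        rw [hdv, W22.trunc_of_le _ _ _ (ht.2.trans h)]
        exact le_min (le_max_right _ _) hC
    simp only [intervalIntegral.integral_const, smul_eq_mul] at h2
    nlinarith [mul_pos ha hs.1]
  · have h1 := v.u_sub hx hmem
    have h2 := intervalIntegral.integral_mono_on h (v.intervalIntegrable_du hx hmem)
      (intervalIntegrable_const (c := a)) fun t ht => by
        rw [hdv, W22.trunc_of_le _ _ _ ht.2]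
        exact (min_le_right _ _).trans hC
    simp only [intervalIntegral.integral_const, smul_eq_mul] at h2
    have h3 := hright x₀ ⟨le_rfl, hmem.2⟩
    nlinarith

/-- A minimizer touches the obstacle at some point. -/
lemma exists_eq_coneObstacle {A s : ℝ} (hA : 0 < A) (hs : s ∈ Ioo (0:ℝ) (1/2)) {u : W22}
    (hu : MemG (coneObstacle A s) u)
    (hmin : ∀ v : W22, MemG (coneObstacle A s) v → graphE u ≤ graphE v) :
    ∃ x ∈ Icc (0:ℝ) 1, u.u x = coneObstacle A s x := by
  by_contra! hne
  obtain ⟨hu0, hu1, hge⟩ := hu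
  have hmem0 : (0:ℝ) ∈ Icc (0:ℝ) 1 := by simp
  have hmem1 : (1:ℝ) ∈ Icc (0:ℝ) 1 := by simp
  have hmemh : (1/2:ℝ) ∈ Icc (0:ℝ) 1 := by constructor <;> norm_num
  obtain ⟨xm, hxm, hδ⟩ := isCompact_Icc.exists_isMinOn ⟨0, hmem0⟩
    (u.continuousOn_u.sub (continuous_coneObstacle A s).continuousOn)
  have hδpos : 0 < u.u xm - coneObstacle A s xm :=
    sub_pos.2 (lt_of_le_of_ne (hge xm hxm) (hne xm hxm).symm)
  set δ := u.u xm - coneObstacle A s xm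
  have hδle : ∀ x ∈ Icc (0:ℝ) 1, δ ≤ u.u x - coneObstacle A s x := fun x hx => hδ hx
  obtain ⟨y, hy, hymin⟩ := isCompact_Icc.exists_isMinOn ⟨0, hmem0⟩ u.continuousOn_du
  have hhalf : A ≤ u.u (1/2) := by
    have := hge _ hmemh
    rwa [coneObstacle_of_le le_rfl, div_mul_cancel₀ _ (by linarith [hs.2])] at this
  have hyneg : u.du y < 0 := by
    by_contra! h
    have h1 := u.u_sub hmemh hmem1
    have h2 := intervalIntegral.integral_nonneg (μ := volume) hmemh.2 fun t ht =>
      h.trans (hymin (show t ∈ Icc (0:ℝ) 1 from ⟨hmemh.1.trans ht.1, ht.2⟩))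
    linarith
  have hzpos : ∃ z ∈ Icc (0:ℝ) 1, 0 ≤ u.du z := by
    by_contra! h
    have h1 := u.u_sub hmem0 hmemh
    have h2 := intervalIntegral.integral_nonneg (μ := volume) (f := fun t => -u.du t) hmemh.1
      fun t ht => neg_nonneg.2 (h t ⟨ht.1, ht.2.trans hmemh.2⟩).le
    rw [intervalIntegral.integral_neg] at h2
    linarith
  obtain ⟨z, hz, hz0⟩ := hzpos
  set η := min δ (-u.du y) with hη
  have hηpos : 0 < η := lt_min hδpos (by linarith)
  have hηy : u.du y + η ≤ 0 := by linarith [min_le_right δ (-u.du y)]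
  have hint : ∫ t in (0:ℝ)..1, u.du t = 0 := by
    rw [← u.u_sub hmem0 hmem1, hu0, hu1, sub_zero]
  obtain ⟨C, v, hv0, hv1, hdv, hlt⟩ := u.exists_trunc_graphE_lt (a := u.du y + η) zero_le_one le_rfl
    (Or.inl rfl) hint.ge hy (by linarith) hz (hηy.trans hz0)
  refine hlt.not_ge (hmin v ⟨hv0, hv1, fun x hx => ?_⟩)
  have h1 := u.u_sub hx hmem1
  have h2 := v.u_sub hx hmem1
  have hi := u.intervalIntegrable_du hx hmem1
  have h3 := intervalIntegral.integral_mono_on hx.2 (v.intervalIntegrable_du hx hmem1)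
    (hi.add (intervalIntegrable_const (c := η))) fun t ht => by
      have hty := hymin (show t ∈ Icc (0:ℝ) 1 from ⟨hx.1.trans ht.1, ht.2⟩)
      rw [hdv, W22.trunc_of_le _ _ _ ht.2]
      exact (min_le_left _ _).trans (max_le (by linarith) (add_le_add_left hty η))
  rw [intervalIntegral.integral_add hi intervalIntegrable_const,
    intervalIntegral.integral_const, smul_eq_mul] at h3
  have h4 := hδle x hx
  have h5 : η ≤ δ := min_le_left _ _
  have h6 : (1 - x) * η ≤ η := mul_le_of_le_one_left hηpos.le (by linarith [hx.1])
  linarith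


/-- A minimizer above a symmetric cone obstacle touches it exactly at `x = 1/2`. -/
theorem stmt10 (A s : ℝ) (hA : 0 < A) (hs : s ∈ Ioo (0:ℝ) (1/2)) (u : W22)
    (hu : MemG (coneObstacle A s) u)
    (hmin : ∀ v : W22, MemG (coneObstacle A s) v → graphE u ≤ graphE v) :
    ∀ x ∈ Icc (0:ℝ) 1, (u.u x = coneObstacle A s x ↔ x = 1/2) := by
  have hlt : ∀ {w : W22}, MemG (coneObstacle A s) w → graphE w = graphE u → ∀ x, 0 ≤ x →
      x < 1/2 → w.u x ≠ coneObstacle A s x := fun hw hE x =>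
    ne_coneObstacle_of_lt hA hs hw fun v hv => hE ▸ hmin v hv
  have hne : ∀ x ∈ Icc (0:ℝ) 1, u.u x = coneObstacle A s x → x = 1/2 := by
    intro x hx h
    rcases lt_trichotomy x (1/2) with h' | h' | h'
    · exact absurd h (hlt hu rfl x hx.1 h')
    · exact h'
    · refine absurd ?_ (hlt hu.reflect u.graphE_reflect (1 - x) (by linarith [hx.2])
        (by linarith))
      rw [coneObstacle_one_sub, ← h]
      simp [W22.reflect]
  refine fun x hx => ⟨hne x hx, ?_⟩
  rintro rfl
  obtain ⟨y, hy, hyt⟩ := exists_eq_coneObstacle hA hs hu hmin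
  rwa [← hne y hy hyt]
end
end

section
/- Let u ∈ C¹(0,1) ∩ W^{1,1}(0,1). Then there exist L > 0 and φ ∈ W^{1,1}(0,L) ∩ C¹(0,L), invertible in W^{1,1} and increasing, such that φ'(s) = 1/√(1+u'(φ(s))²) for all s ∈ (0,L), the continuous extension of φ satisfies φ(0) = 0 and φ(L) = 1, and s ↦ (φ(s), u(φ(s))) is a weak reparametrization of x ↦ (x, u(x)). Moreover, if additionally u ∈ W^{2,2}_loc(0,1), then φ ∈ W^{2,2}_loc(0,L); and if additionally u is concave, then s ↦ (φ(s), u(φ(s))) lies in W^{2,1}((0,L);ℝ²) ∩ W^{2,2}_loc((0,L);ℝ²). -/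
open MeasureTheory Set Topology Filter

noncomputable section

/-- Post-composition with a Lipschitz function preserves absolute continuity. -/
lemma LipschitzWith.comp_absolutelyContinuousOnInterval {F f : ℝ → ℝ} {a b : ℝ} {K : NNReal}
    (hF : LipschitzWith K F) (hf : AbsolutelyContinuousOnInterval f a b) :
    AbsolutelyContinuousOnInterval (fun x => F (f x)) a b := by
  apply squeeze_zero (fun t ↦ ?_) (fun t ↦ ?_) (by simpa using Tendsto.const_mul (K : ℝ) hf)
  · exact Finset.sum_nonneg (fun i hi ↦ by positivity)
  · rw [Finset.mul_sum]
    gcongr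
    exact hF.dist_le_mul _ _

/-- Chain rule, in integrated form, for a Lipschitz `C¹` function of an absolutely continuous
function. -/
lemma comp_eq_add_integral {p dp F G : ℝ → ℝ} {a b : ℝ} {K : NNReal}
    (hdp : IntervalIntegrable dp volume a b)
    (hp : ∀ x ∈ uIcc a b, p x = p a + ∫ s in a..x, dp s)
    (hF : ∀ y, HasDerivAt F (G y) y) (hK : LipschitzWith K F) :
    F (p b) = F (p a) + ∫ x in a..b, G (p x) * dp x := by
  set P : ℝ → ℝ := fun x => p a + ∫ s in a..x, dp s with hP
  have hAC : AbsolutelyContinuousOnInterval P a b := by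
    refine AbsolutelyContinuousOnInterval.add (f := fun _ => p a) ?_
      (hdp.absolutelyContinuousOnInterval_intervalIntegral left_mem_uIcc)
    exact (LipschitzWith.const (p a)).lipschitzOnWith.absolutelyContinuousOnInterval
  have h1 := (hK.comp_absolutelyContinuousOnInterval hAC).integral_deriv_eq_sub
  have h2 : ∫ x in a..b, deriv (fun x => F (P x)) x = ∫ x in a..b, G (p x) * dp x := by
    apply intervalIntegral.integral_congr_ae
    filter_upwards [hdp.ae_hasDerivAt_integral] with x hx hxm
    have hxm' := uIoc_subset_uIcc hxm
    have hd : HasDerivAt P (dp x) x := (hx hxm' a left_mem_uIcc).const_add (p a)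
    have hc : HasDerivAt (fun x => F (P x)) (G (P x) * dp x) x := (hF (P x)).comp x hd
    rw [hc.deriv, hp x hxm']
  have hb : P b = p b := (hp b right_mem_uIcc).symm
  have ha : P a = p a := by simp [hP]
  rw [h2] at h1
  simp only [ha, hb] at h1
  linarith

section ChangeOfVariables

variable {φ : ℝ ≃o ℝ} {φ' : ℝ → ℝ} {c d : ℝ}

lemma integrableOn_image_orderIso_iff (hφ : ∀ s ∈ Ioo c d, HasDerivAt φ (φ' s) s) {S : Set ℝ}
    (hS : MeasurableSet S) (hsub : S ⊆ Ioo c d) (k : ℝ → ℝ) :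
    IntegrableOn k (φ '' S) ↔ IntegrableOn (fun s => φ' s * k (φ s)) S :=
  integrableOn_image_iff_integrableOn_deriv_smul_of_monotoneOn hS
    (fun s hs => (hφ s (hsub hs)).hasDerivWithinAt) (φ.monotone.monotoneOn S) k

lemma intervalIntegral_comp_orderIso (hφ : ∀ s ∈ Ioo c d, HasDerivAt φ (φ' s) s) {a t : ℝ}
    (ha : a ∈ Ioo c d) (ht : t ∈ Ioo c d) (k : ℝ → ℝ) :
    ∫ x in φ a..φ t, k x = ∫ s in a..t, φ' s * k (φ s) := by
  wlog hat : a ≤ t generalizing a t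
  · rw [intervalIntegral.integral_symm, this ht ha (le_of_not_ge hat),
      ← intervalIntegral.integral_symm]
  rw [intervalIntegral.integral_of_le hat, intervalIntegral.integral_of_le (φ.monotone hat),
    ← OrderIso.image_Ioc]
  refine integral_image_eq_integral_deriv_smul_of_monotoneOn measurableSet_Ioc
    (fun s hs => (hφ s ⟨ha.1.trans hs.1, hs.2.trans_lt ht.2⟩).hasDerivWithinAt)
    (φ.monotone.monotoneOn _) k

end ChangeOfVariables

lemma uIcc_subset_Ioo_of_mem {a b c d : ℝ} (ha : a ∈ Ioo c d) (hb : b ∈ Ioo c d) :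
    uIcc a b ⊆ Ioo c d := ordConnected_Ioo.uIcc_subset ha hb

lemma lipschitzWith_one_of_abs_mul_le {F G : ℝ → ℝ} (hF : ∀ y, HasDerivAt F (G y) y)
    (hG : ∀ y, |G y| * (1 + y ^ 2) ≤ 1) : LipschitzWith 1 F := by
  refine lipschitzWith_of_nnnorm_deriv_le (fun y => (hF y).differentiableAt) fun y => ?_
  rw [(hF y).deriv, ← NNReal.coe_le_coe]
  simp only [coe_nnnorm, Real.norm_eq_abs, NNReal.coe_one]
  nlinarith [hG y, abs_nonneg (G y), mul_nonneg (abs_nonneg (G y)) (sq_nonneg y)]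

lemma W22locOn.intervalIntegrable {u du ddu : ℝ → ℝ} {c d a b : ℝ} (h : W22locOn u du ddu c d)
    (ha : a ∈ Ioo c d) (hb : b ∈ Ioo c d) : IntervalIntegrable ddu volume a b := by
  rw [intervalIntegrable_iff]
  refine (h.ddu_loc (min a b) (max a b) ?_ ?_).mono_set Ioc_subset_Icc_self
  · exact lt_min ha.1 hb.1
  · exact max_lt ha.2 hb.2

lemma W22locOn.comp_du {u du ddu F G : ℝ → ℝ} {c d a b : ℝ} {K : NNReal}
    (h : W22locOn u du ddu c d) (ha : a ∈ Ioo c d) (hb : b ∈ Ioo c d)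
    (hF : ∀ y, HasDerivAt F (G y) y) (hK : LipschitzWith K F) :
    F (du b) = F (du a) + ∫ x in a..b, G (du x) * ddu x :=
  comp_eq_add_integral (h.intervalIntegrable ha hb)
    (fun x hx => h.ftc_du a ha x (uIcc_subset_Ioo_of_mem ha hb hx)) hF hK

/-- Second order regularity of a function of the arclength parameter whose derivative is a smooth
function of the slope `u'`. -/
lemma W22locOn.comp_arclength {u du ddu w F G : ℝ → ℝ} {φ : ℝ ≃o ℝ} {L : ℝ}
    (h : W22locOn u du ddu 0 1) (hcont : ContinuousOn du (Ioo 0 1)) (h0 : φ 0 = 0) (h1 : φ L = 1)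
    (hφ : ∀ s ∈ Ioo (0:ℝ) L, HasDerivAt φ (1 / Real.sqrt (1 + (du (φ s)) ^ 2)) s)
    (hF : ∀ y, HasDerivAt F (G y) y) (hGc : Continuous G) (hG : ∀ y, |G y| * (1 + y ^ 2) ≤ 1)
    (hw : ∀ s ∈ Ioo (0:ℝ) L, HasDerivAt w (F (du (φ s))) s) :
    W22locOn w (fun s => F (du (φ s)))
      (fun s => 1 / Real.sqrt (1 + (du (φ s)) ^ 2) * (G (du (φ s)) * ddu (φ s))) 0 L := by
  have hmem : ∀ s ∈ Ioo (0:ℝ) L, φ s ∈ Ioo (0:ℝ) 1 := fun s hs =>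
    ⟨h0 ▸ φ.strictMono hs.1, h1 ▸ φ.strictMono hs.2⟩
  have hFc : Continuous F := continuous_iff_continuousAt.2 fun y => (hF y).continuousAt
  have hv : ContinuousOn (fun s => F (du (φ s))) (Ioo 0 L) :=
    hFc.comp_continuousOn (hcont.comp φ.continuous.continuousOn hmem)
  have hIcc : ∀ a b : ℝ, 0 < a → b < L → Icc a b ⊆ Ioo 0 L := fun a b ha hb =>
    Icc_subset_Ioo ha hb
  have hIcc' : ∀ a b : ℝ, 0 < a → b < L → Icc (φ a) (φ b) ⊆ Ioo 0 1 := fun a b ha hb =>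
    Icc_subset_Ioo (h0 ▸ φ.strictMono ha) (h1 ▸ φ.strictMono hb)
  refine ⟨fun a b ha hb => (hv.mono (hIcc a b ha hb)).integrableOn_Icc, fun a b ha hb => ?_,
    fun a b ha hb => ?_, fun a ha t ht => ?_, fun a ha t ht => ?_⟩
  · refine (integrableOn_image_orderIso_iff hφ measurableSet_Icc (hIcc a b ha hb)
      (fun x => G (du x) * ddu x)).1 ?_
    rw [OrderIso.image_Icc]
    refine (h.ddu_loc _ _ (h0 ▸ φ.strictMono ha) (h1 ▸ φ.strictMono hb)).continuousOn_mul
      (hGc.comp_continuousOn (hcont.mono (hIcc' a b ha hb))) isCompact_Icc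
  · have := (integrableOn_image_orderIso_iff hφ measurableSet_Icc (hIcc a b ha hb)
      (fun x => (1 / Real.sqrt (1 + (du x) ^ 2) * (G (du x)) ^ 2) * (ddu x) ^ 2)).1 (by
        rw [OrderIso.image_Icc]
        refine (h.ddu_sq _ _ (h0 ▸ φ.strictMono ha) (h1 ▸ φ.strictMono hb)).continuousOn_mul
          ?_ isCompact_Icc
        have hc := hcont.mono (hIcc' a b ha hb)
        refine ContinuousOn.mul ?_ ((hGc.comp_continuousOn hc).pow 2)
        refine continuousOn_const.div (Real.continuous_sqrt.comp_continuousOn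
          (continuousOn_const.add (hc.pow 2))) fun x _ => ?_
        positivity)
    refine this.congr_fun (fun s _ => ?_) measurableSet_Icc
    ring
  · have hsub := uIcc_subset_Ioo_of_mem ha ht
    rw [intervalIntegral.integral_eq_sub_of_hasDerivAt (fun s hs => hw s (hsub hs))
      (hv.mono hsub).intervalIntegrable]
    ring
  · rw [← intervalIntegral_comp_orderIso hφ ha ht (fun x => G (du x) * ddu x)]
    exact h.comp_du (hmem a ha) (hmem t ht) hF (lipschitzWith_one_of_abs_mul_le hF hG)

lemma W22locOn.ddu_nonpos_of_concaveOn {u du ddu : ℝ → ℝ} {c d a b : ℝ}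
    (h : W22locOn u du ddu c d) (hu : ∀ x ∈ Ioo c d, HasDerivAt u (du x) x)
    (hconc : ConcaveOn ℝ (Ioo c d) u) (ha : a ∈ Ioo c d) (hb : b ∈ Ioo c d) :
    ∀ᵐ x, x ∈ uIcc a b → ddu x ≤ 0 := by
  have hanti : AntitoneOn du (Ioo c d) := fun x hx y hy hxy => by
    have := hconc.antitoneOn_deriv (fun x hx => (hu x hx).differentiableAt) hx hy hxy
    rwa [(hu x hx).deriv, (hu y hy).deriv] at this
  filter_upwards [(h.intervalIntegrable ha hb).ae_hasDerivAt_integral] with x hx hxm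
  have hxI := uIcc_subset_Ioo_of_mem ha hb hxm
  have hd : HasDerivAt du (ddu x) x := by
    refine ((hx hxm a left_mem_uIcc).const_add (du a)).congr_of_eventuallyEq ?_
    filter_upwards [isOpen_Ioo.mem_nhds hxI] with y hy using h.ftc_du a ha y hy
  exact (hd.hasDerivWithinAt (s := Ioo c d)).nonpos_of_antitoneOn
    ((uniqueDiffWithinAt_iff_accPt).1 (isOpen_Ioo.uniqueDiffWithinAt hxI)) hanti

/-- The total curvature of the graph of a concave function is finite. -/
lemma W22locOn.integrableOn_of_concaveOn {u du ddu G : ℝ → ℝ}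
    (h : W22locOn u du ddu 0 1) (hu : ∀ x ∈ Ioo (0:ℝ) 1, HasDerivAt u (du x) x)
    (hcont : ContinuousOn du (Ioo 0 1)) (hconc : ConcaveOn ℝ (Ioo 0 1) u)
    (hGc : Continuous G) (hG : ∀ y, |G y| * (1 + y ^ 2) ≤ 1) :
    IntegrableOn (fun x => G (du x) * ddu x) (Ioo 0 1) := by
  rw [← integrableOn_Ioc_iff_integrableOn_Ioo]
  obtain ⟨a, -, ha, ha'⟩ := exists_seq_strictAnti_tendsto' (show (0:ℝ) < 1 / 2 by norm_num)
  obtain ⟨b, -, hb, hb'⟩ := exists_seq_strictMono_tendsto' (show (1 / 2 : ℝ) < 1 by norm_num)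
  have haI : ∀ i, a i ∈ Ioo (0:ℝ) 1 := fun i => ⟨(ha i).1, (ha i).2.trans (by norm_num)⟩
  have hbI : ∀ i, b i ∈ Ioo (0:ℝ) 1 := fun i => ⟨lt_trans (by norm_num) (hb i).1, (hb i).2⟩
  have hsub : ∀ i, Icc (a i) (b i) ⊆ Ioo 0 1 := fun i => Icc_subset_Ioo (haI i).1 (hbI i).2
  have hint : ∀ {H : ℝ → ℝ}, Continuous H → ∀ i,
      IntegrableOn (fun x => H (du x) * ddu x) (Ioc (a i) (b i)) := fun hH i =>
    ((h.ddu_loc _ _ (haI i).1 (hbI i).2).continuousOn_mul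
      (hH.comp_continuousOn (hcont.mono (hsub i))) isCompact_Icc).mono_set Ioc_subset_Icc_self
  have hAc : Continuous fun y : ℝ => 1 / (1 + y ^ 2) :=
    continuous_const.div (by fun_prop) fun y => by positivity
  refine integrableOn_Ioc_of_intervalIntegral_norm_bounded (I := Real.pi) (hint hGc) ha' hb'
    (Eventually.of_forall fun i => ?_)
  have hab : a i ≤ b i := ((ha i).2.trans (hb i).1).le
  have hkey := h.comp_du (haI i) (hbI i) Real.hasDerivAt_arctan
    (lipschitzWith_one_of_abs_mul_le Real.hasDerivAt_arctan fun y => by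
      rw [abs_of_nonneg (by positivity)]
      exact (one_div_mul_cancel (by positivity)).le)
  calc ∫ x in Ioc (a i) (b i), ‖G (du x) * ddu x‖
      ≤ ∫ x in Ioc (a i) (b i), -(1 / (1 + (du x) ^ 2) * ddu x) := by
        refine setIntegral_mono_on_ae (hint hGc i).norm (hint hAc i).neg measurableSet_Ioc ?_
        filter_upwards [h.ddu_nonpos_of_concaveOn hu hconc (haI i) (hbI i)] with x hx hxm
        have hx0 := hx (by rw [uIcc_of_le hab]; exact Ioc_subset_Icc_self hxm)
        have hGx : |G (du x)| ≤ 1 / (1 + (du x) ^ 2) := by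
          rw [le_div_iff₀ (by positivity)]; exact hG _
        rw [norm_mul, Real.norm_eq_abs, Real.norm_eq_abs, abs_of_nonpos hx0]
        nlinarith
    _ = Real.arctan (du (a i)) - Real.arctan (du (b i)) := by
        rw [integral_neg, ← intervalIntegral.integral_of_le hab, hkey]
        ring
    _ ≤ Real.pi := by
        linarith [Real.arctan_lt_pi_div_two (du (a i)), Real.neg_pi_div_two_lt_arctan (du (b i))]

lemma sqrt_one_add_sq_pos (y : ℝ) : 0 < Real.sqrt (1 + y ^ 2) := Real.sqrt_pos.2 (by positivity)

lemma hasDerivAt_sqrt_one_add_sq (y : ℝ) :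
    HasDerivAt (fun y : ℝ => Real.sqrt (1 + y ^ 2)) (y / Real.sqrt (1 + y ^ 2)) y := by
  have h := (((hasDerivAt_pow 2 y).const_add 1).sqrt (by positivity : (1 + y ^ 2 : ℝ) ≠ 0))
  convert h using 1
  have := (sqrt_one_add_sq_pos y).ne'
  field_simp
  norm_num [mul_comm]

lemma hasDerivAt_one_div_sqrt_one_add_sq (y : ℝ) :
    HasDerivAt (fun y : ℝ => 1 / Real.sqrt (1 + y ^ 2)) (-y / Real.sqrt (1 + y ^ 2) ^ 3) y := by
  have hs := (sqrt_one_add_sq_pos y).ne'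
  refine ((hasDerivAt_const y (1:ℝ)).div (hasDerivAt_sqrt_one_add_sq y) hs).congr_deriv ?_
  field_simp
  ring

lemma hasDerivAt_div_sqrt_one_add_sq (y : ℝ) :
    HasDerivAt (fun y : ℝ => y / Real.sqrt (1 + y ^ 2)) (1 / Real.sqrt (1 + y ^ 2) ^ 3) y := by
  have hs := (sqrt_one_add_sq_pos y).ne'
  refine ((hasDerivAt_id y).div (hasDerivAt_sqrt_one_add_sq y) hs).congr_deriv ?_
  have h2 : Real.sqrt (1 + y ^ 2) ^ 2 = 1 + y ^ 2 := Real.sq_sqrt (by positivity)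
  simp only [id]
  field_simp
  linarith

lemma abs_neg_div_sqrt_cube_mul_le (y : ℝ) :
    |-y / Real.sqrt (1 + y ^ 2) ^ 3| * (1 + y ^ 2) ≤ 1 := by
  have hs := sqrt_one_add_sq_pos y
  have h2 : Real.sqrt (1 + y ^ 2) ^ 2 = 1 + y ^ 2 := Real.sq_sqrt (by positivity)
  have hy : |y| ≤ Real.sqrt (1 + y ^ 2) := Real.abs_le_sqrt (by linarith)
  rw [abs_div, abs_neg, abs_of_pos (pow_pos hs 3), ← h2, div_mul_eq_mul_div,
    div_le_one (by rw [h2]; positivity)]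
  rw [Real.sqrt_sq hs.le]
  nlinarith [pow_pos hs 2]

lemma abs_one_div_sqrt_cube_mul_le (y : ℝ) :
    |1 / Real.sqrt (1 + y ^ 2) ^ 3| * (1 + y ^ 2) ≤ 1 := by
  have hs := sqrt_one_add_sq_pos y
  have h2 : Real.sqrt (1 + y ^ 2) ^ 2 = 1 + y ^ 2 := Real.sq_sqrt (by positivity)
  have h1 : 1 ≤ Real.sqrt (1 + y ^ 2) := Real.one_le_sqrt.2 (by nlinarith [sq_nonneg y])
  rw [abs_of_pos (by positivity), ← h2, div_mul_eq_mul_div, div_le_one (by rw [h2]; positivity)]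
  rw [Real.sqrt_sq hs.le]
  nlinarith [pow_pos hs 2]

lemma abs_div_sqrt_one_add_sq_le (y : ℝ) : |y / Real.sqrt (1 + y ^ 2)| ≤ 1 := by
  have hs := sqrt_one_add_sq_pos y
  rw [abs_div, abs_of_pos hs, div_le_one hs]
  exact Real.abs_le_sqrt (by linarith)

lemma abs_one_div_sqrt_one_add_sq_le (y : ℝ) : |1 / Real.sqrt (1 + y ^ 2)| ≤ 1 := by
  have hs := sqrt_one_add_sq_pos y
  rw [abs_of_pos (by positivity), div_le_one hs]
  exact Real.one_le_sqrt.2 (by nlinarith [sq_nonneg y])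

lemma continuous_div_sqrt_one_add_sq_pow {f : ℝ → ℝ} (hf : Continuous f) (n : ℕ) :
    Continuous fun y => f y / Real.sqrt (1 + y ^ 2) ^ n :=
  hf.div (by fun_prop) fun y => (pow_pos (sqrt_one_add_sq_pos y) n).ne'

/-- The arclength function of a graph, extended to the whole line with unit slope. -/
lemma exists_orderIso_arclength {du : ℝ → ℝ} (hcont : ContinuousOn du (Ioo (0:ℝ) 1))
    (hdu_int : IntegrableOn du (Ioo (0:ℝ) 1)) :
    ∃ (ψ : ℝ ≃o ℝ) (dψ : ℝ → ℝ), ψ 0 = 0 ∧ IntegrableOn dψ (Icc 0 1) ∧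
      (∀ x, ψ x = ∫ r in (0:ℝ)..x, dψ r) ∧
      ∀ x ∈ Ioo (0:ℝ) 1, HasDerivAt ψ (Real.sqrt (1 + (du x) ^ 2)) x := by
  set h : ℝ → ℝ := (Ioo (0:ℝ) 1).indicator fun x => Real.sqrt (1 + (du x) ^ 2) - 1 with hh
  have hσc : ContinuousOn (fun x => Real.sqrt (1 + (du x) ^ 2) - 1) (Ioo (0:ℝ) 1) :=
    (Real.continuous_sqrt.comp_continuousOn (continuousOn_const.add (hcont.pow 2))).sub
      continuousOn_const
  have hnn : ∀ y : ℝ, 0 ≤ Real.sqrt (1 + y ^ 2) - 1 := fun y =>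
    sub_nonneg.2 (Real.one_le_sqrt.2 (by nlinarith [sq_nonneg y]))
  have h_nonneg : ∀ x, 0 ≤ h x := fun x => indicator_nonneg (fun x _ => hnn _) x
  have h_int : Integrable h := by
    rw [hh, integrable_indicator_iff measurableSet_Ioo]
    refine Integrable.mono' hdu_int.abs (hσc.aestronglyMeasurable measurableSet_Ioo)
      (Eventually.of_forall fun x => ?_)
    rw [Real.norm_eq_abs, abs_of_nonneg (hnn _), sub_le_iff_le_add]
    refine Real.sqrt_le_iff.2 ⟨by positivity, ?_⟩
    nlinarith [abs_nonneg (du x), sq_abs (du x)]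
  have hI : ∀ a b, IntervalIntegrable h volume a b := fun a b => h_int.intervalIntegrable
  set f : ℝ → ℝ := fun x => x + ∫ t in (0:ℝ)..x, h t with hf
  have hsub : ∀ x y, f y - f x = (y - x) + ∫ t in x..y, h t := fun x y => by
    simp only [hf]
    rw [← intervalIntegral.integral_add_adjacent_intervals (hI 0 x) (hI x y)]
    ring
  have hmono : StrictMono f := fun x y hxy => by
    have := hsub x y
    have := intervalIntegral.integral_nonneg hxy.le (μ := volume) fun t _ => h_nonneg t
    linarith
  have hf0 : f 0 = 0 := by simp [hf]
  have hfc : Continuous f := by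
    exact continuous_id.add (intervalIntegral.continuous_primitive hI 0)
  have hsurj : Function.Surjective f := by
    refine hfc.surjective (tendsto_atTop_mono' _ ?_ tendsto_id)
      (tendsto_atBot_mono' _ ?_ tendsto_id)
    · filter_upwards [eventually_ge_atTop 0] with x hx
      have := intervalIntegral.integral_nonneg hx (μ := volume) fun t _ => h_nonneg t
      simp only [hf, id]; linarith
    · filter_upwards [eventually_le_atBot 0] with x hx
      have := intervalIntegral.integral_nonneg hx (μ := volume) fun t _ => h_nonneg t
      simp only [hf, id]; rw [intervalIntegral.integral_symm]; linarith
  refine ⟨hmono.orderIsoOfSurjective f hsurj, fun x => 1 + h x, hf0, ?_, fun x => ?_,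
    fun x hx => ?_⟩
  · exact (integrableOn_const (by simp)).add h_int.integrableOn
  · rw [intervalIntegral.integral_add (by simp) (hI 0 x)]
    simp [hf]
  · have hat : ContinuousAt h x := by
      refine (hσc.continuousAt (isOpen_Ioo.mem_nhds hx)).congr ?_
      filter_upwards [isOpen_Ioo.mem_nhds hx] with y hy
      rw [hh, indicator_of_mem hy]
    have hd := (hasDerivAt_id x).add (intervalIntegral.integral_hasDerivAt_right (hI 0 x)
      h_int.aestronglyMeasurable.stronglyMeasurableAtFilter hat)
    refine HasDerivAt.congr_deriv hd ?_
    rw [hh, indicator_of_mem hx]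
    ring

/-- Arclength reparametrization of graphs. -/
theorem stmt11 (u du : ℝ → ℝ)
    (hC1 : ∀ x ∈ Ioo (0:ℝ) 1, HasDerivAt u (du x) x)
    (hcont : ContinuousOn du (Ioo (0:ℝ) 1))
    (hu_int : IntegrableOn u (Ioo (0:ℝ) 1))
    (hdu_int : IntegrableOn du (Ioo (0:ℝ) 1)) :
    ∃ L : ℝ, 0 < L ∧ ∃ φ : ℝ → ℝ,
      -- φ ∈ W^{1,1}(0,L) ∩ C¹(0,L), increasing, with continuous extension φ(0)=0, φ(L)=1
      ContinuousOn φ (Icc (0:ℝ) L) ∧ StrictMonoOn φ (Icc (0:ℝ) L) ∧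
      φ 0 = 0 ∧ φ L = 1 ∧ (∀ s ∈ Ioo (0:ℝ) L, φ s ∈ Ioo (0:ℝ) 1) ∧
      -- the arclength ODE
      (∀ s ∈ Ioo (0:ℝ) L, HasDerivAt φ (1 / Real.sqrt (1 + (du (φ s))^2)) s) ∧
      -- φ is invertible in W^{1,1}: hence s ↦ (φ s, u (φ s)) is a weak
      -- reparametrization of x ↦ (x, u x)
      InvertibleW11On φ 0 L 0 1 ∧
      -- if u ∈ W^{2,2}_loc(0,1) then φ ∈ W^{2,2}_loc(0,L)
      (∀ ddu : ℝ → ℝ, W22locOn u du ddu 0 1 →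
        ∃ dφ ddφ : ℝ → ℝ, W22locOn φ dφ ddφ 0 L ∧
          ∀ s ∈ Ioo (0:ℝ) L, dφ s = 1 / Real.sqrt (1 + (du (φ s))^2)) ∧
      -- if moreover u is concave then the reparametrized curve lies in
      -- W^{2,1}((0,L);ℝ²) ∩ W^{2,2}_loc((0,L);ℝ²)
      (∀ ddu : ℝ → ℝ, W22locOn u du ddu 0 1 → ConcaveOn ℝ (Ioo (0:ℝ) 1) u →
        ∃ dv₁ dv₂ ddv₁ ddv₂ : ℝ → ℝ,
          W22locOn φ dv₁ ddv₁ 0 L ∧ W22locOn (fun s => u (φ s)) dv₂ ddv₂ 0 L ∧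
          IntegrableOn dv₁ (Ioo (0:ℝ) L) ∧ IntegrableOn dv₂ (Ioo (0:ℝ) L) ∧
          IntegrableOn ddv₁ (Ioo (0:ℝ) L) ∧ IntegrableOn ddv₂ (Ioo (0:ℝ) L)) := by
  obtain ⟨ψ, dψ, hψ0, hdψ, hψ, hψ'⟩ := exists_orderIso_arclength hcont hdu_int
  have h0 : ψ.symm 0 = 0 := ψ.symm_apply_eq.2 hψ0.symm
  have h1 : ψ.symm (ψ 1) = 1 := ψ.symm_apply_apply 1
  have hmem : ∀ s ∈ Ioo (0:ℝ) (ψ 1), ψ.symm s ∈ Ioo (0:ℝ) 1 := fun s hs =>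
    ⟨h0 ▸ ψ.symm.strictMono hs.1, h1 ▸ ψ.symm.strictMono hs.2⟩
  have hφ : ∀ s ∈ Ioo (0:ℝ) (ψ 1),
      HasDerivAt ψ.symm (1 / Real.sqrt (1 + (du (ψ.symm s)) ^ 2)) s := fun s hs => by
    rw [one_div]
    exact HasDerivAt.of_local_left_inverse ψ.symm.continuous.continuousAt (hψ' _ (hmem s hs))
      (sqrt_one_add_sq_pos _).ne' (Eventually.of_forall ψ.apply_symm_apply)
  have hv : ∀ s ∈ Ioo (0:ℝ) (ψ 1), HasDerivAt (fun s => u (ψ.symm s))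
      (du (ψ.symm s) / Real.sqrt (1 + (du (ψ.symm s)) ^ 2)) s := fun s hs => by
    have := (hC1 _ (hmem s hs)).comp s (hφ s hs)
    rwa [mul_one_div] at this
  have hφreg : ∀ ddu, W22locOn u du ddu 0 1 → _ := fun ddu h =>
    h.comp_arclength hcont h0 h1 hφ hasDerivAt_one_div_sqrt_one_add_sq
      (continuous_div_sqrt_one_add_sq_pow continuous_neg 3) abs_neg_div_sqrt_cube_mul_le hφ
  have hbdd : ∀ {F : ℝ → ℝ}, Continuous F → (∀ y, |F y| ≤ 1) →
      IntegrableOn (fun s => F (du (ψ.symm s))) (Ioo 0 (ψ 1)) := fun hF hb =>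
    Integrable.mono' (integrableOn_const (C := (1 : ℝ)) (by simp))
      ((hF.comp_continuousOn (hcont.comp ψ.symm.continuous.continuousOn hmem)).aestronglyMeasurable
        measurableSet_Ioo) (Eventually.of_forall fun s => hb _)
  refine ⟨ψ 1, hψ0 ▸ ψ.strictMono one_pos, ψ.symm, ψ.symm.continuous.continuousOn,
    ψ.symm.strictMono.strictMonoOn _, h0, h1, hmem, hφ, ⟨ψ, dψ, hdψ, fun s _ => ?_, fun t ht =>
      ⟨hmem t ht, ψ.apply_symm_apply t⟩, fun s hs =>
      ⟨⟨hψ0 ▸ ψ.strictMono hs.1, ψ.strictMono hs.2⟩, ψ.symm_apply_apply s⟩⟩,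
    fun ddu h => ⟨_, _, hφreg ddu h, fun s _ => rfl⟩, fun ddu h hconc => ?_⟩
  · rw [hψ0, zero_add, hψ s]
  · have hcurv : ∀ {G : ℝ → ℝ}, Continuous G → (∀ y, |G y| * (1 + y ^ 2) ≤ 1) → _ :=
      fun {G} hGc hG => (integrableOn_image_orderIso_iff hφ measurableSet_Ioo Subset.rfl
        (fun x => G (du x) * ddu x)).1 (by
          rw [OrderIso.image_Ioo, h0, h1]
          exact h.integrableOn_of_concaveOn hC1 hcont hconc hGc hG)
    exact ⟨_, _, _, _, hφreg ddu h,
      h.comp_arclength hcont h0 h1 hφ hasDerivAt_div_sqrt_one_add_sq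
        (continuous_div_sqrt_one_add_sq_pow continuous_const 3) abs_one_div_sqrt_cube_mul_le hv,
      hbdd (by simpa using continuous_div_sqrt_one_add_sq_pow (continuous_const (y := 1)) 1)
        abs_one_div_sqrt_one_add_sq_le,
      hbdd (by simpa using continuous_div_sqrt_one_add_sq_pow continuous_id 1)
        abs_div_sqrt_one_add_sq_le,
      hcurv (continuous_div_sqrt_one_add_sq_pow continuous_neg 3) abs_neg_div_sqrt_cube_mul_le,
      hcurv (continuous_div_sqrt_one_add_sq_pow continuous_const 3) abs_one_div_sqrt_cube_mul_le⟩
end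
end

section
/- Let ψ be an admissible obstacle and let γ ∈ P_ψ be a ∩-shaped pseudograph, concave on the top, with graph reparametrization u and parameters β₁, β₂. If β₁ = 0 (no vertical segment at the left endpoint), then L(γ) ≤ u'(0) + √(1+u'(0)²), and if β₂ = 1, then L(γ) ≤ |u'(1)| + √(1+u'(1)²), where u'(0) and u'(1) denote the one-sided limits of u' at the endpoints. -/
open MeasureTheory Set Topology Filter

noncomputable section

/-- A primitive of a function that is integrable from `a` to the points of `(c,d)` is continuous
on `(c,d)`. -/
theorem continuousOn_of_ftc {f g : ℝ → ℝ} {a c d : ℝ} (ha : a ∈ Ioo c d)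
    (hg : ∀ p q : ℝ, c < p → q < d → IntegrableOn g (Icc p q))
    (hf : ∀ t ∈ Ioo c d, f t = f a + ∫ s in a..t, g s) : ContinuousOn f (Ioo c d) := by
  intro t ht
  obtain ⟨p, hcp, hp⟩ := exists_between (lt_min ha.1 ht.1)
  obtain ⟨q, hq, hqd⟩ := exists_between (max_lt ha.2 ht.2)
  obtain ⟨hpa, hpt⟩ := lt_min_iff.1 hp
  obtain ⟨haq, htq⟩ := max_lt_iff.1 hq
  have hpq : p ≤ q := (hpa.trans haq).le
  have hI : IntervalIntegrable g volume p q :=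
    (intervalIntegrable_iff_integrableOn_Icc_of_le hpq).2 (hg p q hcp hqd)
  have hprim := intervalIntegral.continuousOn_primitive_interval' (a := a) hI
    (by rw [uIcc_of_le hpq]; exact ⟨hpa.le, haq.le⟩)
  rw [uIcc_of_le hpq] at hprim
  have hcont : ContinuousAt (fun b => f a + ∫ s in a..b, g s) t :=
    continuousAt_const.add (hprim.continuousAt (Icc_mem_nhds hpt htq))
  refine (hcont.congr ?_).continuousWithinAt
  filter_upwards [Ioo_mem_nhds ht.1 ht.2] with s hs using (hf s hs).symm

/-- A primitive of a function that is continuous on `(c,d)` is differentiable there. -/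
theorem hasDerivAt_of_ftc {f g : ℝ → ℝ} {a c d t : ℝ} (ht : t ∈ Ioo c d)
    (hg : IntervalIntegrable g volume a t) (hcont : ContinuousOn g (Ioo c d))
    (hf : ∀ t ∈ Ioo c d, f t = f a + ∫ s in a..t, g s) : HasDerivAt f (g t) t := by
  have h := (intervalIntegral.integral_hasDerivAt_right hg
    (hcont.stronglyMeasurableAtFilter isOpen_Ioo t ht)
    (hcont.continuousAt (isOpen_Ioo.mem_nhds ht))).const_add (f a)
  refine h.congr_of_eventuallyEq ?_
  filter_upwards [Ioo_mem_nhds ht.1 ht.2] with s hs using hf s hs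

theorem HasDerivAt.eq_zero_of_eqOn_const {f : ℝ → ℝ} {f' t c : ℝ} {s : Set ℝ}
    (h : HasDerivAt f f' t) (hs : UniqueDiffWithinAt ℝ s t) (ht : t ∈ s)
    (hf : ∀ r ∈ s, f r = c) : f' = 0 :=
  hs.eq_deriv s h.hasDerivWithinAt
    ((hasDerivWithinAt_const t s c).congr hf (hf t ht))

/-- A continuous nowhere vanishing function that is nonpositive at one point of an interval is
nonpositive on the interval. -/
theorem ContinuousOn.nonpos_of_ne_zero {f : ℝ → ℝ} {s : Set ℝ} (hf : ContinuousOn f s)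
    (hs : s.OrdConnected) (hne : ∀ t ∈ s, f t ≠ 0) {a : ℝ} (ha : a ∈ s) (hfa : f a ≤ 0)
    {t : ℝ} (ht : t ∈ s) : f t ≤ 0 := by
  by_contra! hpos
  obtain ⟨r, hr, hr0⟩ := hs.isPreconnected.intermediate_value ha ht hf ⟨hfa, hpos.le⟩
  exact hne r hr hr0

theorem sqrt_sq_add_sq_le_of_le_mul {a b d : ℝ} (ha : 0 ≤ a) (hb : b ≤ d * a) :
    Real.sqrt (a ^ 2 + b ^ 2) ≤ (d + Real.sqrt (1 + d ^ 2)) * a - b := by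
  set r := Real.sqrt (1 + d ^ 2) with hr
  have hr2 : r ^ 2 = 1 + d ^ 2 := Real.sq_sqrt (by positivity)
  have hr0 : 0 ≤ r := Real.sqrt_nonneg _
  have hdr : 0 ≤ d + r := by
    have := Real.abs_le_sqrt (show d ^ 2 ≤ 1 + d ^ 2 by linarith)
    linarith [neg_abs_le d]
  refine Real.sqrt_le_iff.2 ⟨by nlinarith, ?_⟩
  have h := mul_nonneg (mul_nonneg ha hdr) (sub_nonneg.2 hb)
  linear_combination 2 * h - a ^ 2 * hr2

namespace Curve

variable (γ : Curve)

theorem continuousOn_dx : ContinuousOn γ.dx (Ioo 0 1) :=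
  continuousOn_of_ftc (a := 1 / 2) (by norm_num) γ.ddx_loc (γ.ftc_dx _ (by norm_num))

theorem continuousOn_dy : ContinuousOn γ.dy (Ioo 0 1) :=
  continuousOn_of_ftc (a := 1 / 2) (by norm_num) γ.ddy_loc (γ.ftc_dy _ (by norm_num))

theorem hasDerivAt_x {t : ℝ} (ht : t ∈ Ioo (0 : ℝ) 1) : HasDerivAt γ.x (γ.dx t) t :=
  hasDerivAt_of_ftc ht ((intervalIntegrable_iff_integrableOn_Icc_of_le ht.1.le).2
    (γ.dx_int.mono_set (Icc_subset_Icc_right ht.2.le))) γ.continuousOn_dx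
    fun s hs => γ.ftc_x s (Ioo_subset_Icc_self hs)

theorem hasDerivAt_y {t : ℝ} (ht : t ∈ Ioo (0 : ℝ) 1) : HasDerivAt γ.y (γ.dy t) t :=
  hasDerivAt_of_ftc ht ((intervalIntegrable_iff_integrableOn_Icc_of_le ht.1.le).2
    (γ.dy_int.mono_set (Icc_subset_Icc_right ht.2.le))) γ.continuousOn_dy
    fun s hs => γ.ftc_y s (Ioo_subset_Icc_self hs)

theorem continuousOn_x : ContinuousOn γ.x (Icc 0 1) := by
  have h := intervalIntegral.continuousOn_primitive_interval' (a := 0)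
    ((intervalIntegrable_iff_integrableOn_Icc_of_le zero_le_one).2 γ.dx_int) left_mem_uIcc
  rw [uIcc_of_le zero_le_one] at h
  exact (continuousOn_const.add h).congr γ.ftc_x

variable {γ}

theorem Immersed.dy_ne_zero (h : γ.Immersed) {t : ℝ} (ht : t ∈ Ioo (0 : ℝ) 1)
    (hx : γ.dx t = 0) : γ.dy t ≠ 0 := by
  obtain ⟨ε, hε, hs⟩ := h
  intro hy
  have := hs t ht
  simp only [speed1, hx, hy] at this
  norm_num at this
  linarith

/-- A curve from `(0,0)` to `(1,0)` moving to the right with slope at most `d` (up to a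
reflection `σ` in the horizontal axis) has length at most `d + √(1 + d²)`. -/
theorem lenE_le_of_slope_le {σ d : ℝ} (hσ : σ ^ 2 = 1)
    (hx0 : γ.x 0 = 0) (hy0 : γ.y 0 = 0) (hx1 : γ.x 1 = 1) (hy1 : γ.y 1 = 0)
    (hdx : ∀ t ∈ Ioo (0 : ℝ) 1, 0 ≤ γ.dx t)
    (hdy : ∀ t ∈ Ioo (0 : ℝ) 1, σ * γ.dy t ≤ d * γ.dx t) :
    lenE γ ≤ ENNReal.ofReal (d + Real.sqrt (1 + d ^ 2)) := by
  set c := d + Real.sqrt (1 + d ^ 2) with hc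
  have hle : ∀ t ∈ Ioo (0 : ℝ) 1, speed1 γ.toCurve1 t ≤ c * γ.dx t - σ * γ.dy t := by
    intro t ht
    have h := sqrt_sq_add_sq_le_of_le_mul (hdx t ht) (hdy t ht)
    rwa [mul_pow, hσ, one_mul] at h
  have hIx : IntegrableOn γ.dx (Ioo 0 1) := γ.dx_int.mono_set Ioo_subset_Icc_self
  have hIy : IntegrableOn γ.dy (Ioo 0 1) := γ.dy_int.mono_set Ioo_subset_Icc_self
  have hx : ∫ t in Ioo (0 : ℝ) 1, γ.dx t = 1 := by
    have h := γ.ftc_x 1 (by simp)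
    rw [hx0, hx1, intervalIntegral.integral_of_le zero_le_one, integral_Ioc_eq_integral_Ioo] at h
    linarith
  have hy : ∫ t in Ioo (0 : ℝ) 1, γ.dy t = 0 := by
    have h := γ.ftc_y 1 (by simp)
    rw [hy0, hy1, intervalIntegral.integral_of_le zero_le_one, integral_Ioc_eq_integral_Ioo] at h
    linarith
  calc lenE γ ≤ ∫⁻ t in Ioo (0 : ℝ) 1, ENNReal.ofReal (c * γ.dx t - σ * γ.dy t) :=
        setLIntegral_mono' measurableSet_Ioo fun t ht => ENNReal.ofReal_le_ofReal (hle t ht)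
    _ = ENNReal.ofReal (∫ t in Ioo (0 : ℝ) 1, (c * γ.dx t - σ * γ.dy t)) := by
        refine (ofReal_integral_eq_lintegral_ofReal ((hIx.const_mul c).sub (hIy.const_mul σ))
          ?_).symm
        filter_upwards [ae_restrict_mem measurableSet_Ioo] with t ht
        exact (Real.sqrt_nonneg _).trans (hle t ht)
    _ = ENNReal.ofReal c := by
        rw [integral_sub (hIx.const_mul c) (hIy.const_mul σ), integral_const_mul,
          integral_const_mul, hx, hy]
        simp

end Curve

namespace W22locOn

variable {u du ddu : ℝ → ℝ}

theorem hasDerivAt (h : W22locOn u du ddu 0 1) {x : ℝ} (hx : x ∈ Ioo (0 : ℝ) 1) :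
    HasDerivAt u (du x) x := by
  have hm : (1 / 2 : ℝ) ∈ Ioo (0 : ℝ) 1 := by norm_num
  have hc : ContinuousOn du (Ioo 0 1) := continuousOn_of_ftc hm h.ddu_loc (h.ftc_du _ hm)
  refine hasDerivAt_of_ftc hx ?_ hc (h.ftc_u _ hm)
  exact (hc.mono (ordConnected_Ioo.uIcc_subset hm hx)).intervalIntegrable

theorem antitoneOn_du (h : W22locOn u du ddu 0 1) (hconc : ConcaveOn ℝ (Ioo (0 : ℝ) 1) u) :
    AntitoneOn du (Ioo 0 1) :=
  (hconc.antitoneOn_deriv fun _ hx => (h.hasDerivAt hx).differentiableAt).congr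
    fun _ hx => (h.hasDerivAt hx).deriv

theorem du_le (h : W22locOn u du ddu 0 1) (hconc : ConcaveOn ℝ (Ioo (0 : ℝ) 1) u) {d₀ : ℝ}
    (hd : Tendsto du (𝓝[>] (0 : ℝ)) (𝓝 d₀)) {x : ℝ} (hx : x ∈ Ioo (0 : ℝ) 1) : du x ≤ d₀ := by
  refine ge_of_tendsto hd ?_
  filter_upwards [Ioo_mem_nhdsGT hx.1] with s hs
  exact h.antitoneOn_du hconc ⟨hs.1, hs.2.trans hx.2⟩ hx hs.2.le

theorem le_du (h : W22locOn u du ddu 0 1) (hconc : ConcaveOn ℝ (Ioo (0 : ℝ) 1) u) {d₁ : ℝ}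
    (hd : Tendsto du (𝓝[<] (1 : ℝ)) (𝓝 d₁)) {x : ℝ} (hx : x ∈ Ioo (0 : ℝ) 1) : d₁ ≤ du x := by
  refine le_of_tendsto hd ?_
  filter_upwards [Ioo_mem_nhdsLT hx.2] with s hs
  exact h.antitoneOn_du hconc hx ⟨hx.1.trans hs.1, hs.2⟩ hs.1.le

end W22locOn

namespace CapShaped

variable {γ : Curve} {β₁ β₂ : ℝ} {u du ddu : ℝ → ℝ}

theorem x_mem_Ioo (h : CapShaped γ β₁ β₂ u du ddu) {t : ℝ} (ht : t ∈ Ioo β₁ β₂) :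
    γ.x t ∈ Ioo (0 : ℝ) 1 := by
  obtain ⟨h0, h12, h1⟩ := h.hβ
  have hmono : StrictMonoOn γ.x (Icc β₁ β₂) := by
    refine strictMonoOn_of_deriv_pos (convex_Icc _ _)
      (γ.continuousOn_x.mono (Icc_subset_Icc h0 h1)) fun s hs => ?_
    rw [interior_Icc] at hs
    rw [(γ.hasDerivAt_x (Ioo_subset_Ioo h0 h1 hs)).deriv]
    exact h.pos s hs
  have hl := hmono (left_mem_Icc.2 h12.le) (Ioo_subset_Icc_self ht) ht.1
  have hr := hmono (Ioo_subset_Icc_self ht) (right_mem_Icc.2 h12.le) ht.2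
  rw [h.left β₁ (right_mem_Icc.2 h0)] at hl
  rw [h.right β₂ (left_mem_Icc.2 h1)] at hr
  exact ⟨hl, hr⟩

theorem dy_eq (h : CapShaped γ β₁ β₂ u du ddu) {t : ℝ} (ht : t ∈ Ioo β₁ β₂) :
    γ.dy t = du (γ.x t) * γ.dx t := by
  have ht' : t ∈ Ioo (0 : ℝ) 1 := Ioo_subset_Ioo h.hβ.1 h.hβ.2.2 ht
  have hcomp : HasDerivAt (fun s => u (γ.x s)) (du (γ.x t) * γ.dx t) t :=
    (h.reg.hasDerivAt (h.x_mem_Ioo ht)).comp t (γ.hasDerivAt_x ht')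
  refine (γ.hasDerivAt_y ht').unique (hcomp.congr_of_eventuallyEq ?_)
  filter_upwards [Ioo_mem_nhds ht.1 ht.2] with s hs using (h.graph s hs).symm

theorem dx_eq_zero_left (h : CapShaped γ β₁ β₂ u du ddu) {t : ℝ} (ht : t ∈ Ioc 0 β₁) :
    γ.dx t = 0 :=
  (γ.hasDerivAt_x ⟨ht.1, ht.2.trans_lt (h.hβ.2.1.trans_le h.hβ.2.2)⟩).eq_zero_of_eqOn_const
    (uniqueDiffOn_Icc (ht.1.trans_le ht.2) t ⟨ht.1.le, ht.2⟩) ⟨ht.1.le, ht.2⟩ h.left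

theorem dx_eq_zero_right (h : CapShaped γ β₁ β₂ u du ddu) {t : ℝ} (ht : t ∈ Ico β₂ 1) :
    γ.dx t = 0 :=
  (γ.hasDerivAt_x ⟨(h.hβ.1.trans_lt h.hβ.2.1).trans_le ht.1, ht.2⟩).eq_zero_of_eqOn_const
    (uniqueDiffOn_Icc (ht.1.trans_lt ht.2) t ⟨ht.1, ht.2.le⟩) ⟨ht.1, ht.2.le⟩ h.right

theorem dy_le (h : CapShaped γ β₁ β₂ u du ddu) (hγ : γ.Immersed) (hβ₁ : β₁ = 0) {d : ℝ}
    (hd : ∀ x ∈ Ioo (0 : ℝ) 1, du x ≤ d) {t : ℝ} (ht : t ∈ Ioo (0 : ℝ) 1) :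
    γ.dy t ≤ d * γ.dx t := by
  obtain ⟨-, h12, h1⟩ := h.hβ
  have hgraph : ∀ s ∈ Ioo β₁ β₂, γ.dy s ≤ d * γ.dx s := fun s hs => by
    rw [h.dy_eq hs]
    exact mul_le_mul_of_nonneg_right (hd _ (h.x_mem_Ioo hs)) (h.pos s hs).le
  rcases lt_or_ge t β₂ with htβ | hβt
  · exact hgraph t ⟨hβ₁ ▸ ht.1, htβ⟩
  have hβ : β₂ ∈ Ioo (0 : ℝ) 1 := ⟨hβ₁ ▸ h12, hβt.trans_lt ht.2⟩
  have hcorner : γ.dy β₂ ≤ d * γ.dx β₂ := by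
    have hx := γ.continuousOn_dx.continuousAt (isOpen_Ioo.mem_nhds hβ)
    have hy := γ.continuousOn_dy.continuousAt (isOpen_Ioo.mem_nhds hβ)
    refine le_of_tendsto_of_tendsto (hy.mono_left nhdsWithin_le_nhds)
      ((hx.const_mul d).mono_left nhdsWithin_le_nhds) (b := 𝓝[<] β₂) ?_
    filter_upwards [Ioo_mem_nhdsLT h12] with s hs using hgraph s hs
  rw [h.dx_eq_zero_right ⟨le_rfl, hβ.2⟩, mul_zero] at hcorner
  rw [h.dx_eq_zero_right ⟨hβt, ht.2⟩, mul_zero]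
  exact (γ.continuousOn_dy.mono (Ico_subset_Ioo_left hβ.1)).nonpos_of_ne_zero ordConnected_Ico
    (fun s hs => hγ.dy_ne_zero ⟨hβ.1.trans_le hs.1, hs.2⟩ (h.dx_eq_zero_right hs))
    ⟨le_rfl, hβ.2⟩ hcorner ⟨hβt, ht.2⟩

theorem le_dy (h : CapShaped γ β₁ β₂ u du ddu) (hγ : γ.Immersed) (hβ₂ : β₂ = 1) {d : ℝ}
    (hd : ∀ x ∈ Ioo (0 : ℝ) 1, d ≤ du x) {t : ℝ} (ht : t ∈ Ioo (0 : ℝ) 1) :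
    d * γ.dx t ≤ γ.dy t := by
  obtain ⟨h0, h12, -⟩ := h.hβ
  have hgraph : ∀ s ∈ Ioo β₁ β₂, d * γ.dx s ≤ γ.dy s := fun s hs => by
    rw [h.dy_eq hs]
    exact mul_le_mul_of_nonneg_right (hd _ (h.x_mem_Ioo hs)) (h.pos s hs).le
  rcases lt_or_ge β₁ t with hβt | htβ
  · exact hgraph t ⟨hβt, hβ₂ ▸ ht.2⟩
  have hβ : β₁ ∈ Ioo (0 : ℝ) 1 := ⟨ht.1.trans_le htβ, hβ₂ ▸ h12⟩
  have hcorner : d * γ.dx β₁ ≤ γ.dy β₁ := by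
    have hx := γ.continuousOn_dx.continuousAt (isOpen_Ioo.mem_nhds hβ)
    have hy := γ.continuousOn_dy.continuousAt (isOpen_Ioo.mem_nhds hβ)
    refine le_of_tendsto_of_tendsto ((hx.const_mul d).mono_left nhdsWithin_le_nhds)
      (hy.mono_left nhdsWithin_le_nhds) (b := 𝓝[>] β₁) ?_
    filter_upwards [Ioo_mem_nhdsGT h12] with s hs using hgraph s hs
  rw [h.dx_eq_zero_left ⟨hβ.1, le_rfl⟩, mul_zero] at hcorner
  rw [h.dx_eq_zero_left ⟨ht.1, htβ⟩, mul_zero]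
  have hneg := ((γ.continuousOn_dy.mono (Ioc_subset_Ioo_right hβ.2)).neg).nonpos_of_ne_zero
    ordConnected_Ioc
    (fun s hs => neg_ne_zero.2
      (hγ.dy_ne_zero ⟨hs.1, hs.2.trans_lt hβ.2⟩ (h.dx_eq_zero_left hs)))
    ⟨hβ.1, le_rfl⟩ (neg_nonpos.2 hcorner) (t := t) ⟨ht.1, htβ⟩
  exact neg_nonpos.1 hneg

end CapShaped

/-- A length bound for one-sided graphs. -/
theorem stmt16 (ψ : ℝ → ℝ) (hψ : Admissible ψ) (γ : Curve) (β₁ β₂ : ℝ)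
    (u du ddu : ℝ → ℝ) (hP : MemP ψ γ) (hcap : CapShaped γ β₁ β₂ u du ddu)
    (hconc : ConcaveOn ℝ (Ioo (0:ℝ) 1) u) :
    (β₁ = 0 → ∀ d₀ : ℝ, Tendsto du (𝓝[>] (0:ℝ)) (𝓝 d₀) →
      lenE γ ≤ ENNReal.ofReal (d₀ + Real.sqrt (1 + d₀^2))) ∧
    (β₂ = 1 → ∀ d₁ : ℝ, Tendsto du (𝓝[<] (1:ℝ)) (𝓝 d₁) →
      lenE γ ≤ ENNReal.ofReal (|d₁| + Real.sqrt (1 + d₁^2))) := by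
  obtain ⟨⟨himm, hdx, -⟩, hx0, hy0, hx1, hy1, -⟩ := hP
  refine ⟨fun hβ d₀ hd => ?_, fun hβ d₁ hd => ?_⟩
  · refine Curve.lenE_le_of_slope_le (σ := 1) (by norm_num) hx0 hy0 hx1 hy1 hdx fun t ht => ?_
    rw [one_mul]
    exact hcap.dy_le himm hβ (fun x hx => hcap.reg.du_le hconc hd hx) ht
  · rw [← sq_abs d₁]
    refine Curve.lenE_le_of_slope_le (σ := -1) (by norm_num) hx0 hy0 hx1 hy1 hdx fun t ht => ?_
    have h := hcap.le_dy himm hβ (fun x hx => hcap.reg.le_du hconc hd hx) ht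
    nlinarith [mul_nonneg (show 0 ≤ |d₁| + d₁ by linarith [neg_abs_le d₁]) (hdx t ht)]
end
end
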